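/- Let H be a semisimple Hopf algebra over an algebraically closed field k of characteristic 0 with normalized integral Λ, and let V be a simple H-module. Define the Frobenius-Schur indicator ν_V = χ_V(Λ₁Λ₂). Then ν_V ∈ {0, 1, -1}; ν_V = 0 iff V is not self-dual; ν_V = 1 iff there is a nondegenerate bilinear form σ on V with σ(hv, w) = σ(v, S(h)w) and σ symmetric; ν_V = -1 iff there is such a nondegenerate form that is skew-symmetric. -/

import Mathlib

open TensorProduct

namespace FrobeniusSchur

open Coalgebra HopfAlgebra WithConv
open Algebra.TensorProduct (includeLeft includeRight)

section Convolution

variable {k H B : Type*} [Field k] [Ring H] [HopfAlgebra k H] [Ring B] [Algebra k B]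

lemma algHom_mul_antipode (s : H →ₐ[k] B) :
    toConv s.toLinearMap * toConv (s.toLinearMap ∘ₗ antipode k) = 1 := by
  ext h
  rw [(ℛ k h).convMul_apply]
  simpa using congr(s $(sum_mul_antipode_eq_algebraMap_counit (ℛ k h)))

lemma antipode_mul_algHom (s : H →ₐ[k] B) :
    toConv (s.toLinearMap ∘ₗ antipode k) * toConv s.toLinearMap = 1 := by
  ext h
  rw [(ℛ k h).convMul_apply]
  simpa using congr(s $(sum_antipode_mul_eq_algebraMap_counit (ℛ k h)))

lemma comul_eq_includeLeft_mul_includeRight :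
    (toConv (comul (R := k) (A := H))) =
      toConv (includeLeft : H →ₐ[k] H ⊗[k] H).toLinearMap *
        toConv (includeRight : H →ₐ[k] H ⊗[k] H).toLinearMap := by
  ext h
  rw [(ℛ k h).convMul_apply]
  simp [← (ℛ k h).eq]

/-- `Δ(h₁) (1 ⊗ S(h₂)) = h ⊗ 1`. -/
lemma comul_mul_includeRight_antipode :
    toConv (comul (R := k) (A := H)) *
      toConv ((includeRight : H →ₐ[k] H ⊗[k] H).toLinearMap ∘ₗ antipode k) =
      toConv (includeLeft : H →ₐ[k] H ⊗[k] H).toLinearMap := by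
  rw [comul_eq_includeLeft_mul_includeRight, mul_assoc, algHom_mul_antipode, mul_one]

/-- `(S(h₁) ⊗ 1) Δ(h₂) = 1 ⊗ h`. -/
lemma includeLeft_antipode_mul_comul :
    toConv ((includeLeft : H →ₐ[k] H ⊗[k] H).toLinearMap ∘ₗ antipode k) *
      toConv (comul (R := k) (A := H)) =
      toConv (includeRight : H →ₐ[k] H ⊗[k] H).toLinearMap := by
  rw [comul_eq_includeLeft_mul_includeRight, ← mul_assoc, antipode_mul_algHom, one_mul]

lemma comul_antipode_eq_mul :
    toConv (comul (R := k) (A := H) ∘ₗ antipode k) =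
      toConv ((includeRight : H →ₐ[k] H ⊗[k] H).toLinearMap ∘ₗ antipode k) *
      toConv ((includeLeft : H →ₐ[k] H ⊗[k] H).toLinearMap ∘ₗ antipode k) := by
  refine (left_inv_eq_right_inv (a := toConv (comul (R := k) (A := H))) ?_
    (algHom_mul_antipode (Bialgebra.comulAlgHom k H))).symm
  rw [comul_eq_includeLeft_mul_includeRight, mul_assoc,
    ← mul_assoc (toConv ((includeLeft : H →ₐ[k] H ⊗[k] H).toLinearMap ∘ₗ antipode k)),
    antipode_mul_algHom, one_mul, antipode_mul_algHom]

lemma comul_antipode (h : H) :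
    comul (R := k) (antipode k h) =
      TensorProduct.map (antipode k) (antipode k) (TensorProduct.comm k H H (comul (R := k) h)) := by
  have := congr(ofConv $(comul_antipode_eq_mul (k := k) (H := H)) h)
  refine this.trans ?_
  change (toConv _ * toConv _ : WithConv (H →ₗ[k] H ⊗[k] H)) h = _
  rw [(ℛ k h).convMul_apply, ← (ℛ k h).eq]
  simp

lemma comul_antipode_antipode (h : H) :
    comul (R := k) (antipode k (antipode k h)) =
      TensorProduct.map (antipode k ∘ₗ antipode k) (antipode k ∘ₗ antipode k)
        (comul (R := k) h) := by
  rw [comul_antipode, comul_antipode, ← (ℛ k h).eq]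
  simp

/-- The antipode followed by an algebra homomorphism, as a homomorphism to the opposite. -/
noncomputable def opAntipode (s : H →ₐ[k] B) : H →ₐ[k] Bᵐᵒᵖ :=
  s.op.comp (antipodeAlgHomOp k H)

/-- A linear map regarded as a map to the opposite algebra. -/
noncomputable def opLin (f : H →ₗ[k] B) : H →ₗ[k] Bᵐᵒᵖ :=
  (MulOpposite.opLinearEquiv k).toLinearMap ∘ₗ f

lemma opLin_mul_apply {h : H} (r : Repr k h (H × H)) (f g : H →ₗ[k] B) :
    (toConv (opLin f) * toConv (opLin g)) h =
      MulOpposite.op (∑ i ∈ r.index, g (r.right i) * f (r.left i)) := by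
  rw [r.convMul_apply]
  simp [opLin]

lemma opLin_antipode_mul (s : H →ₐ[k] B) :
    toConv (opLin (s.toLinearMap ∘ₗ antipode k)) *
      toConv (opLin (s.toLinearMap ∘ₗ antipode k ∘ₗ antipode k)) = 1 :=
  algHom_mul_antipode (opAntipode s)

lemma opLin_antipode_mul' (s : H →ₐ[k] B) :
    toConv (opLin (s.toLinearMap ∘ₗ antipode k ∘ₗ antipode k)) *
      toConv (opLin (s.toLinearMap ∘ₗ antipode k)) = 1 :=
  antipode_mul_algHom (opAntipode s)

/-- `Δ(S²(x₂)) (S(x₁) ⊗ 1) = 1 ⊗ S²(x)`. -/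
lemma sum_comul_antipode_sq_mul (x : H) (r : Repr k x (H × H)) :
    ∑ i ∈ r.index, comul (R := k) (antipode k (antipode k (r.right i))) *
      (antipode k (r.left i) ⊗ₜ[k] (1 : H)) = (1 : H) ⊗ₜ[k] antipode k (antipode k x) := by
  have h2 : toConv (opLin (comul (R := k) (A := H) ∘ₗ antipode k ∘ₗ antipode k)) =
      toConv (opLin ((includeLeft : H →ₐ[k] H ⊗[k] H).toLinearMap ∘ₗ antipode k ∘ₗ antipode k)) *
      toConv (opLin ((includeRight : H →ₐ[k] H ⊗[k] H).toLinearMap ∘ₗ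
        antipode k ∘ₗ antipode k)) := by
    ext x
    rw [opLin_mul_apply (ℛ k x)]
    simp [opLin, comul_antipode_antipode, ← (ℛ k x).eq]
  have h3 : toConv (opLin ((includeLeft : H →ₐ[k] H ⊗[k] H).toLinearMap ∘ₗ antipode k)) *
      toConv (opLin (comul (R := k) (A := H) ∘ₗ antipode k ∘ₗ antipode k)) =
      toConv (opLin ((includeRight : H →ₐ[k] H ⊗[k] H).toLinearMap ∘ₗ
        antipode k ∘ₗ antipode k)) := by
    rw [h2, ← mul_assoc, opLin_antipode_mul, one_mul]
  have h4 := (opLin_mul_apply r _ _).symm.trans congr(ofConv $h3 x)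
  exact MulOpposite.op_injective h4

/-- `(1 ⊗ S(y₂)) (y₁ ⊗ S²(y₂)) = y ⊗ 1`, with the two copies of `y₂` consecutive. -/
lemma sum_antipode_mul_map_comul (y : H) (r : Repr k y (H × H)) :
    ∑ i ∈ r.index, ((1 : H) ⊗ₜ[k] antipode k (r.right i)) *
      TensorProduct.map LinearMap.id (antipode k ∘ₗ antipode k) (comul (R := k) (r.left i)) =
      y ⊗ₜ[k] (1 : H) := by
  have h2 : toConv (opLin (TensorProduct.map LinearMap.id (antipode k ∘ₗ antipode k) ∘ₗ
        comul (R := k) (A := H))) =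
      toConv (opLin (includeLeft : H →ₐ[k] H ⊗[k] H).toLinearMap) *
      toConv (opLin ((includeRight : H →ₐ[k] H ⊗[k] H).toLinearMap ∘ₗ
        antipode k ∘ₗ antipode k)) := by
    ext x
    rw [opLin_mul_apply (ℛ k x)]
    simp [opLin, ← (ℛ k x).eq]
  have h3 : toConv (opLin (TensorProduct.map LinearMap.id (antipode k ∘ₗ antipode k) ∘ₗ
        comul (R := k) (A := H))) *
      toConv (opLin ((includeRight : H →ₐ[k] H ⊗[k] H).toLinearMap ∘ₗ antipode k)) =
      toConv (opLin (includeLeft : H →ₐ[k] H ⊗[k] H).toLinearMap) := by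
    rw [h2, mul_assoc, opLin_antipode_mul', mul_one]
  have h4 := (opLin_mul_apply r _ _).symm.trans congr(ofConv $h3 y)
  exact MulOpposite.op_injective h4

end Convolution

lemma sum_counit_right_smul {k H : Type*} [Field k] [AddCommGroup H] [Module k H] [Coalgebra k H]
    {h : H} {ι : Type*} (r : Repr k h ι) :
    ∑ i ∈ r.index, counit (R := k) (r.right i) • r.left i = h := by
  have h1 := congr(TensorProduct.rid k H $(sum_tmul_counit_eq r))
  rw [map_sum] at h1
  simpa only [TensorProduct.rid_tmul, one_smul] using h1

section Integral

variable {k H : Type*} [Field k] [Ring H] [HopfAlgebra k H] {Λ : H}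

lemma antipode_integral_mul (hint : ∀ h : H, h * Λ = counit (R := k) h • Λ) (h : H) :
    antipode k Λ * h = counit (R := k) h • antipode k Λ := by
  have h1 : ∑ i ∈ (ℛ k h).index, antipode k ((ℛ k h).left i * Λ) * (ℛ k h).right i =
      antipode k Λ * h := by
    simp_rw [hint, map_smul, smul_mul_assoc, ← mul_smul_comm, ← Finset.mul_sum, sum_counit_smul]
  simp_rw [antipode_mul_antidistrib, mul_assoc, ← Finset.mul_sum, sum_antipode_mul_eq_smul] at h1
  simpa using h1.symm

lemma antipode_integral (hint : ∀ h : H, h * Λ = counit (R := k) h • Λ)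
    (hnorm : counit (R := k) Λ = 1) : antipode k Λ = Λ := by
  have h1 := antipode_integral_mul hint Λ
  rw [hint, counit_antipode, hnorm, one_smul, one_smul] at h1
  exact h1.symm

lemma integral_mul (hint : ∀ h : H, h * Λ = counit (R := k) h • Λ)
    (hnorm : counit (R := k) Λ = 1) (h : H) : Λ * h = counit (R := k) h • Λ := by
  simpa [antipode_integral hint hnorm] using antipode_integral_mul hint h

/-- `Λ₁ h ⊗ Λ₂ = Λ₁ ⊗ Λ₂ S(h)`. -/
lemma comul_integral_mul_tmul (hint : ∀ h : H, h * Λ = counit (R := k) h • Λ)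
    (hnorm : counit (R := k) Λ = 1) (h : H) :
    comul (R := k) Λ * (h ⊗ₜ 1) = comul (R := k) Λ * (1 ⊗ₜ antipode k h) := by
  have h1 := congr(ofConv $(comul_mul_includeRight_antipode (k := k) (H := H)) h)
  replace h1 : (toConv comul * toConv ((includeRight : H →ₐ[k] H ⊗[k] H).toLinearMap ∘ₗ
    antipode k) : WithConv (H →ₗ[k] H ⊗[k] H)) h = h ⊗ₜ 1 := h1
  rw [(ℛ k h).convMul_apply] at h1
  rw [← h1, Finset.mul_sum]
  simp only [← mul_assoc]
  change ∑ i ∈ (ℛ k h).index, comul Λ * comul ((ℛ k h).left i) *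
    (1 ⊗ₜ antipode k ((ℛ k h).right i)) = _
  simp only [← Bialgebra.comul_mul, integral_mul hint hnorm, map_smul,
    smul_mul_assoc, ← mul_smul_comm, ← Finset.mul_sum]
  congr 1
  simp only [← TensorProduct.tmul_smul, ← map_smul, ← TensorProduct.tmul_sum, ← map_sum,
    sum_counit_smul]

/-- `S(h) Λ₁ ⊗ Λ₂ = Λ₁ ⊗ h Λ₂`. -/
lemma tmul_mul_comul_integral (hint : ∀ h : H, h * Λ = counit (R := k) h • Λ) (h : H) :
    (antipode k h ⊗ₜ 1) * comul (R := k) Λ = (1 ⊗ₜ h) * comul (R := k) Λ := by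
  have h1 := congr(ofConv $(includeLeft_antipode_mul_comul (k := k) (H := H)) h)
  replace h1 : (toConv ((includeLeft : H →ₐ[k] H ⊗[k] H).toLinearMap ∘ₗ
    antipode k) * toConv comul : WithConv (H →ₗ[k] H ⊗[k] H)) h = 1 ⊗ₜ h := h1
  rw [(ℛ k h).convMul_apply] at h1
  rw [← h1, Finset.sum_mul]
  simp only [mul_assoc]
  change _ = ∑ i ∈ (ℛ k h).index, (antipode k ((ℛ k h).left i) ⊗ₜ[k] (1 : H)) *
    (comul (R := k) ((ℛ k h).right i) * comul Λ)
  simp only [← Bialgebra.comul_mul, hint, map_smul,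
    mul_smul_comm, ← smul_mul_assoc, ← Finset.sum_mul]
  congr 1
  simp only [TensorProduct.smul_tmul', ← map_smul, ← TensorProduct.sum_tmul, ← map_sum,
    sum_counit_right_smul]

end Integral

section Contraction

variable {k H : Type*} [Field k] [Ring H] [Algebra k H]

/-- The contraction `a ⊗ b ↦ φ(b) a`. -/
noncomputable def contractRight (φ : Module.Dual k H) : H ⊗[k] H →ₗ[k] H :=
  (TensorProduct.rid k H).toLinearMap ∘ₗ φ.lTensor H

/-- The contraction `a ⊗ b ↦ φ(a) b`. -/
noncomputable def contractLeft (φ : Module.Dual k H) : H ⊗[k] H →ₗ[k] H :=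
  (TensorProduct.lid k H).toLinearMap ∘ₗ φ.rTensor H

@[simp]
lemma contractRight_tmul (φ : Module.Dual k H) (a b : H) :
    contractRight φ (a ⊗ₜ b) = φ b • a := by
  simp [contractRight]

@[simp]
lemma contractLeft_tmul (φ : Module.Dual k H) (a b : H) :
    contractLeft φ (a ⊗ₜ b) = φ a • b := by
  simp [contractLeft]

/-- The contraction `contractRight φ x` as a linear function of `φ`. -/
noncomputable def contractRightHom (x : H ⊗[k] H) : Module.Dual k H →ₗ[k] H where
  toFun φ := contractRight φ x
  map_add' φ ψ := by simp [contractRight, LinearMap.lTensor_add]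
  map_smul' c φ := by simp [contractRight, LinearMap.lTensor_smul]

lemma contractRight_mul_tmul_one (φ : Module.Dual k H) (x : H ⊗[k] H) (h : H) :
    contractRight φ (x * (h ⊗ₜ 1)) = contractRight φ x * h := by
  induction x with
  | zero => simp
  | tmul a b => simp
  | add x y hx hy => simp [add_mul, hx, hy]

lemma contractRight_tmul_one_mul (φ : Module.Dual k H) (x : H ⊗[k] H) (h : H) :
    contractRight φ ((h ⊗ₜ 1) * x) = h * contractRight φ x := by
  induction x with
  | zero => simp
  | tmul a b => simp
  | add x y hx hy => simp [mul_add, hx, hy]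

lemma contractRight_mul_one_tmul (φ : Module.Dual k H) (x : H ⊗[k] H) (h : H) :
    contractRight φ (x * (1 ⊗ₜ h)) = contractRight (φ ∘ₗ LinearMap.mulRight k h) x := by
  induction x with
  | zero => simp
  | tmul a b => simp
  | add x y hx hy => simp [add_mul, hx, hy]

lemma contractRight_one_tmul_mul (φ : Module.Dual k H) (x : H ⊗[k] H) (h : H) :
    contractRight φ ((1 ⊗ₜ h) * x) = contractRight (φ ∘ₗ LinearMap.mulLeft k h) x := by
  induction x with
  | zero => simp
  | tmul a b => simp
  | add x y hx hy => simp [mul_add, hx, hy]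

lemma contractLeft_mul_tmul_one (φ : Module.Dual k H) (x : H ⊗[k] H) (h : H) :
    contractLeft φ (x * (h ⊗ₜ 1)) = contractLeft (φ ∘ₗ LinearMap.mulRight k h) x := by
  induction x with
  | zero => simp
  | tmul a b => simp
  | add x y hx hy => simp [add_mul, hx, hy]

lemma contractLeft_tmul_one_mul (φ : Module.Dual k H) (x : H ⊗[k] H) (h : H) :
    contractLeft φ ((h ⊗ₜ 1) * x) = contractLeft (φ ∘ₗ LinearMap.mulLeft k h) x := by
  induction x with
  | zero => simp
  | tmul a b => simp
  | add x y hx hy => simp [mul_add, hx, hy]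

lemma contractLeft_mul_one_tmul (φ : Module.Dual k H) (x : H ⊗[k] H) (h : H) :
    contractLeft φ (x * (1 ⊗ₜ h)) = contractLeft φ x * h := by
  induction x with
  | zero => simp
  | tmul a b => simp
  | add x y hx hy => simp [add_mul, hx, hy]

lemma contractLeft_one_tmul_mul (φ : Module.Dual k H) (x : H ⊗[k] H) (h : H) :
    contractLeft φ ((1 ⊗ₜ h) * x) = h * contractLeft φ x := by
  induction x with
  | zero => simp
  | tmul a b => simp
  | add x y hx hy => simp [mul_add, hx, hy]

lemma exists_eq_sum_contractRight_coord {ι : Type*} (b : Module.Basis ι k H) (x : H ⊗[k] H) :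
    ∃ s : Finset ι, x = ∑ j ∈ s, contractRight (b.coord j) x ⊗ₜ[k] b j := by
  classical
  have key : ∀ j, TensorProduct.equivFinsuppOfBasisRight b x j = contractRight (b.coord j) x := by
    intro j
    induction x with
    | zero => simp
    | tmul a c => simp
    | add x y hx hy => simp [hx, hy]
  refine ⟨(TensorProduct.equivFinsuppOfBasisRight b x).support, ?_⟩
  conv_lhs => rw [← (TensorProduct.equivFinsuppOfBasisRight b).symm_apply_apply x]
  rw [TensorProduct.equivFinsuppOfBasisRight_symm_apply]
  exact Finset.sum_congr rfl fun j _ => by rw [key]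

end Contraction

section FiniteDimensional

variable {k H : Type*} [Field k] [Ring H] [HopfAlgebra k H] {Λ : H}

lemma contractRight_comul_integral_mul (hint : ∀ h : H, h * Λ = counit (R := k) h • Λ)
    (hnorm : counit (R := k) Λ = 1) (φ : Module.Dual k H) (h : H) :
    contractRight φ (comul (R := k) Λ) * h =
      contractRight (φ ∘ₗ LinearMap.mulRight k (antipode k h)) (comul (R := k) Λ) := by
  rw [← contractRight_mul_tmul_one, comul_integral_mul_tmul hint hnorm,
    contractRight_mul_one_tmul]

lemma antipode_mul_contractRight_comul_integral
    (hint : ∀ h : H, h * Λ = counit (R := k) h • Λ) (φ : Module.Dual k H) (h : H) :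
    antipode k h * contractRight φ (comul (R := k) Λ) =
      contractRight (φ ∘ₗ LinearMap.mulLeft k h) (comul (R := k) Λ) := by
  rw [← contractRight_tmul_one_mul, tmul_mul_comul_integral hint, contractRight_one_tmul_mul]

lemma exists_contractRight_comul_integral_eq (hint : ∀ h : H, h * Λ = counit (R := k) h • Λ)
    (hnorm : counit (R := k) Λ = 1) (h : H) :
    ∃ φ : Module.Dual k H, contractRight φ (comul (R := k) Λ) = h := by
  obtain ⟨s, hs⟩ := exists_eq_sum_contractRight_coord (Module.Basis.ofVectorSpace k H)
    (comul (R := k) Λ)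
  set b := Module.Basis.ofVectorSpace k H
  have h1 := mul_antipode_lTensor_comul_apply (R := k) Λ
  rw [hs, hnorm] at h1
  simp only [map_sum, LinearMap.lTensor_tmul, LinearMap.mul'_apply, map_one,
    contractRight_comul_integral_mul hint hnorm] at h1
  refine ⟨(∑ j ∈ s, b.coord j ∘ₗ LinearMap.mulRight k (antipode k (antipode k (b j)))) ∘ₗ
    LinearMap.mulRight k (antipode k h), ?_⟩
  rw [← contractRight_comul_integral_mul hint hnorm]
  change contractRightHom (comul Λ) _ * h = h
  rw [map_sum]
  exact (congrArg (· * h) h1).trans (one_mul h)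

lemma finite_of_integral (hint : ∀ h : H, h * Λ = counit (R := k) h • Λ)
    (hnorm : counit (R := k) Λ = 1) : Module.Finite k H := by
  classical
  refine ⟨⟨(ℛ k Λ).index.image (ℛ k Λ).left, eq_top_iff.2 fun h _ => ?_⟩⟩
  obtain ⟨φ, rfl⟩ := exists_contractRight_comul_integral_eq hint hnorm h
  rw [← (ℛ k Λ).eq, map_sum]
  refine Submodule.sum_mem _ fun i hi => ?_
  rw [contractRight_tmul]
  exact Submodule.smul_mem _ _ (Submodule.subset_span (Finset.mem_coe.2
    (Finset.mem_image_of_mem _ hi)))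

lemma antipode_injective_of_integral (hint : ∀ h : H, h * Λ = counit (R := k) h • Λ)
    (hnorm : counit (R := k) Λ = 1) : Function.Injective (antipode k : H →ₗ[k] H) := by
  rw [injective_iff_map_eq_zero]
  intro h hh
  obtain ⟨φ, hφ⟩ := exists_contractRight_comul_integral_eq hint hnorm (1 : H)
  have := contractRight_comul_integral_mul hint hnorm φ h
  rw [hφ, hh, one_mul] at this
  simpa [contractRight] using this

lemma antipode_bijective_of_integral (hint : ∀ h : H, h * Λ = counit (R := k) h • Λ)
    (hnorm : counit (R := k) Λ = 1) : Function.Bijective (antipode k : H →ₗ[k] H) := by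
  have := finite_of_integral hint hnorm
  have h1 := antipode_injective_of_integral hint hnorm
  exact ⟨h1, LinearMap.injective_iff_surjective.1 h1⟩

lemma contractRight_comul_integral_injective (hint : ∀ h : H, h * Λ = counit (R := k) h • Λ)
    (hnorm : counit (R := k) Λ = 1) {φ : Module.Dual k H}
    (hφ : contractRight φ (comul (R := k) Λ) = 0) : φ = 0 := by
  have := finite_of_integral hint hnorm
  have hT : Function.Surjective (contractRightHom (comul (R := k) Λ)) :=
    exists_contractRight_comul_integral_eq hint hnorm
  exact (injective_iff_map_eq_zero _).1 ((LinearMap.injective_iff_surjective_of_finrank_eq_finrank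
    Subspace.dual_finrank_eq).2 hT) φ hφ

end FiniteDimensional

section SquareTrace

variable {k H : Type*} [Field k] [Ring H] [HopfAlgebra k H]

variable (k H) in
/-- The square of the antipode. -/
noncomputable def antipodeSq : Module.End k H :=
  antipode k ∘ₗ antipode k

lemma antipodeSq_apply (h : H) : antipodeSq k H h = antipode k (antipode k h) := rfl

lemma antipodeSq_mul (a b : H) : antipodeSq k H (a * b) = antipodeSq k H a * antipodeSq k H b := by
  simp [antipodeSq_apply, antipode_mul_antidistrib]

lemma antipodeSq_mul_mulLeft (a : H) :
    antipodeSq k H * LinearMap.mulLeft k a = LinearMap.mulLeft k (antipodeSq k H a) *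
      antipodeSq k H := by
  ext x
  simp [antipodeSq_mul]

variable (k H) in
/-- The functional `b ↦ Tr(x ↦ b S²(x))`. -/
noncomputable def squareTrace : Module.Dual k H :=
  LinearMap.trace k H ∘ₗ LinearMap.mulRight k (antipodeSq k H) ∘ₗ LinearMap.mul k H

lemma squareTrace_apply (b : H) :
    squareTrace k H b = LinearMap.trace k H (LinearMap.mulLeft k b * antipodeSq k H) := rfl

lemma squareTrace_mul (a b : H) :
    squareTrace k H (a * b) = squareTrace k H (b * antipodeSq k H a) := by
  rw [squareTrace_apply, squareTrace_apply, LinearMap.mulLeft_mul, LinearMap.mulLeft_mul]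
  change LinearMap.trace k H (LinearMap.mulLeft k a * LinearMap.mulLeft k b * _) =
    LinearMap.trace k H (LinearMap.mulLeft k b * LinearMap.mulLeft k _ * _)
  rw [mul_assoc, LinearMap.trace_mul_comm, mul_assoc, mul_assoc, antipodeSq_mul_mulLeft]

/-- The action `h ↦ φ(h₁) h₂` of the dual of a Hopf algebra. -/
noncomputable def hit (φ : Module.Dual k H) : Module.End k H :=
  contractLeft φ ∘ₗ comul

lemma hit_apply (φ : Module.Dual k H) (h : H) : hit φ h = contractLeft φ (comul h) := rfl

lemma hit_eq_sum (φ : Module.Dual k H) {h : H} {ι : Type*} (r : Repr k h ι) :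
    hit φ h = ∑ i ∈ r.index, φ (r.left i) • r.right i := by
  rw [hit_apply, ← r.eq]
  simp

lemma sum_smul_contractLeft_coord {ι : Type*} [Fintype ι] (b : Module.Basis ι k H)
    (φ : Module.Dual k H) (x : H ⊗[k] H) :
    ∑ j, φ (b j) • contractLeft (b.coord j) x = contractLeft φ x := by
  induction x with
  | zero => simp
  | tmul a c =>
    conv_rhs => rw [← b.sum_dual_apply_smul_coord φ]
    simp only [contractLeft_tmul, LinearMap.sum_apply, Finset.sum_smul, LinearMap.smul_apply,
      smul_eq_mul, mul_smul]
  | add x y hx hy => simp only [map_add, smul_add, Finset.sum_add_distrib, hx, hy]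

/-- `φ(d₁ S(d₂)) d₃ = φ(1) d`. -/
lemma sum_contractLeft_mul_antipode (φ : Module.Dual k H) {d : H} (r : Repr k d (H × H)) :
    ∑ i ∈ r.index, contractLeft (φ ∘ₗ LinearMap.mulLeft k (r.left i) ∘ₗ antipode k)
      (comul (R := k) (r.right i)) = φ 1 • d := by
  let F : H ⊗[k] (H ⊗[k] H) →ₗ[k] H := (TensorProduct.lid k H).toLinearMap ∘ₗ
    (φ ∘ₗ LinearMap.mul' k H ∘ₗ (antipode k).lTensor H).rTensor H ∘ₗ
      (TensorProduct.assoc k H H H).symm.toLinearMap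
  have hF := congr(F $(sum_tmul_tmul_eq r (fun i => ℛ k (r.left i)) (fun i => ℛ k (r.right i))))
  simp only [map_sum, F, LinearMap.comp_apply, LinearEquiv.coe_coe, TensorProduct.assoc_symm_tmul,
    LinearMap.rTensor_tmul, LinearMap.lTensor_tmul, LinearMap.mul'_apply,
    TensorProduct.lid_tmul] at hF
  have h1 : ∀ i ∈ r.index, contractLeft (φ ∘ₗ LinearMap.mulLeft k (r.left i) ∘ₗ antipode k)
      (comul (R := k) (r.right i)) = ∑ j ∈ (ℛ k (r.right i)).index,
        φ (r.left i * antipode k ((ℛ k (r.right i)).left j)) • (ℛ k (r.right i)).right j := by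
    intro i _
    rw [← (ℛ k (r.right i)).eq]
    simp
  rw [Finset.sum_congr rfl h1, ← hF]
  simp only [← Finset.sum_smul, ← map_sum, sum_mul_antipode_eq_smul, map_smul, smul_eq_mul]
  simp only [mul_comm _ (φ 1), mul_smul, ← Finset.smul_sum, sum_counit_smul]

lemma sum_hit_coord_mul_hit {ι : Type*} [Fintype ι] (b : Module.Basis ι k H)
    (φ : Module.Dual k H) :
    ∑ j, hit (b.coord j) * hit (φ ∘ₗ LinearMap.mulRight k (antipode k (b j))) = φ 1 • 1 := by
  ext d
  simp only [LinearMap.sum_apply, Module.End.mul_apply, LinearMap.smul_apply, Module.End.one_apply,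
    hit_eq_sum _ (ℛ k d), map_sum, map_smul, ← sum_contractLeft_mul_antipode φ (ℛ k d)]
  rw [Finset.sum_comm]
  refine Finset.sum_congr rfl fun i _ => ?_
  rw [← sum_smul_contractLeft_coord b]
  rfl

lemma mulLeft_hit_mul_antipodeSq {ι : Type*} [Fintype ι] (b : Module.Basis ι k H)
    (φ : Module.Dual k H) (h : H) :
    LinearMap.mulLeft k (hit φ h) * antipodeSq k H =
      ∑ j, hit (φ ∘ₗ LinearMap.mulRight k (antipode k (b j))) *
        (LinearMap.mulLeft k h * antipodeSq k H) * hit (b.coord j) := by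
  ext x
  simp only [LinearMap.sum_apply, Module.End.mul_apply, LinearMap.mulLeft_apply]
  rw [hit_apply, ← contractLeft_mul_one_tmul, antipodeSq_apply,
    ← sum_comul_antipode_sq_mul x (ℛ k x), Finset.mul_sum, map_sum]
  simp only [← mul_assoc, ← Bialgebra.comul_mul, contractLeft_mul_tmul_one,
    hit_eq_sum (b.coord _) (ℛ k x), map_sum, map_smul, Finset.mul_sum, mul_smul_comm]
  rw [Finset.sum_comm]
  refine Finset.sum_congr rfl fun i _ => ?_
  have key : φ ∘ₗ LinearMap.mulRight k (antipode k ((ℛ k x).left i)) =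
      ∑ j, b.coord j ((ℛ k x).left i) • (φ ∘ₗ LinearMap.mulRight k (antipode k (b j))) := by
    ext y
    conv_lhs => rw [← b.sum_repr ((ℛ k x).left i)]
    simp only [LinearMap.comp_apply, LinearMap.mulRight_apply, map_sum, map_smul, Finset.mul_sum,
      mul_smul_comm, LinearMap.sum_apply, LinearMap.smul_apply, b.coord_apply]
  rw [key]
  simp only [hit_apply, antipodeSq_apply]
  generalize h * antipode k (antipode k ((ℛ k x).right i)) = z
  induction comul (R := k) z with
  | zero => simp
  | tmul a c => simp [Finset.sum_smul, mul_smul]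
  | add x y hx hy => simp only [map_add, smul_add, Finset.sum_add_distrib, hx, hy]

variable [Module.Finite k H]

lemma squareTrace_hit (φ : Module.Dual k H) (h : H) :
    squareTrace k H (hit φ h) = φ 1 * squareTrace k H h := by
  let b := Module.finBasis k H
  rw [squareTrace_apply, mulLeft_hit_mul_antipodeSq b, map_sum]
  have : ∀ j, LinearMap.trace k H (hit (φ ∘ₗ LinearMap.mulRight k (antipode k (b j))) *
        (LinearMap.mulLeft k h * antipodeSq k H) * hit (b.coord j)) =
      LinearMap.trace k H (LinearMap.mulLeft k h * antipodeSq k H *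
        (hit (b.coord j) * hit (φ ∘ₗ LinearMap.mulRight k (antipode k (b j))))) := by
    intro j
    rw [mul_assoc, LinearMap.trace_mul_comm, mul_assoc]
  simp only [this]
  rw [← map_sum, ← Finset.mul_sum, sum_hit_coord_mul_hit, mul_smul_comm, mul_one, map_smul,
    smul_eq_mul, squareTrace_apply]

lemma squareTrace_integral {Λ : H} (hint : ∀ h : H, h * Λ = counit (R := k) h • Λ)
    (hnorm : counit (R := k) Λ = 1) : squareTrace k H Λ = 1 := by
  have : LinearMap.mulLeft k Λ * antipodeSq k H = (counit (R := k)).smulRight Λ := by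
    ext x
    simp [antipodeSq_apply, integral_mul hint hnorm]
  rw [squareTrace_apply, this, LinearMap.trace_smulRight, hnorm]

end SquareTrace

section Modular

variable {k H : Type*} [Field k] [Ring H] [HopfAlgebra k H]

lemma dual_contractRight (f φ : Module.Dual k H) (x : H ⊗[k] H) :
    φ (contractRight f x) = f (contractLeft φ x) := by
  induction x with
  | zero => simp
  | tmul a b => simp [mul_comm]
  | add x y hx hy => simp [hx, hy]

lemma contractRight_comul_of_hit {f : Module.Dual k H}
    (hf : ∀ (φ : Module.Dual k H) (h : H), f (hit φ h) = φ 1 * f h) (h : H) :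
    contractRight f (comul (R := k) h) = f h • 1 := by
  rw [← sub_eq_zero, ← Module.forall_dual_apply_eq_zero_iff k]
  intro φ
  rw [map_sub, dual_contractRight, ← hit_apply, hf, map_smul, smul_eq_mul, mul_comm, sub_self]

lemma comul_hit (θ : Module.Dual k H) (h : H) :
    comul (R := k) (hit θ h) = (hit θ).rTensor H (comul (R := k) h) := by
  let G : H ⊗[k] (H ⊗[k] H) →ₗ[k] H ⊗[k] H :=
    (TensorProduct.lid k (H ⊗[k] H)).toLinearMap ∘ₗ θ.rTensor (H ⊗[k] H)
  have h1 : ∀ x : H ⊗[k] H, G (comul.lTensor H x) = comul (R := k) (contractLeft θ x) := by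
    intro x
    induction x with
    | zero => simp
    | tmul a b => simp [G]
    | add x y hx hy => simp [hx, hy]
  have h2 : ∀ x : H ⊗[k] H, G (TensorProduct.assoc k H H H (comul.rTensor H x)) =
      (hit θ).rTensor H x := by
    intro x
    induction x with
    | zero => simp
    | tmul a b =>
      simp only [LinearMap.rTensor_tmul, hit_apply]
      induction comul (R := k) a with
      | zero => simp
      | tmul c d => simp [G, TensorProduct.smul_tmul']
      | add x y hx hy => simp only [TensorProduct.add_tmul, map_add, hx, hy]
    | add x y hx hy => simp only [map_add, hx, hy]
  rw [hit_apply, ← h1, ← coassoc_apply, h2]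

lemma antipodeSq_bijective {Λ : H} (hint : ∀ h : H, h * Λ = counit (R := k) h • Λ)
    (hnorm : counit (R := k) Λ = 1) : Function.Bijective (antipodeSq k H) := by
  have := antipode_bijective_of_integral hint hnorm
  exact this.comp this

variable [Module.Finite k H]

lemma eq_smul_squareTrace {Λ : H} (hint : ∀ h : H, h * Λ = counit (R := k) h • Λ)
    (hnorm : counit (R := k) Λ = 1) {f : Module.Dual k H}
    (hf : ∀ (φ : Module.Dual k H) (h : H), f (hit φ h) = φ 1 * f h) :
    f = f Λ • squareTrace k H := by
  rw [← sub_eq_zero]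
  refine contractRight_comul_integral_injective hint hnorm ?_
  change contractRightHom (comul Λ) _ = 0
  rw [map_sub, map_smul, sub_eq_zero]
  change contractRight f (comul Λ) = f Λ • contractRight _ (comul Λ)
  rw [contractRight_comul_of_hit hf, contractRight_comul_of_hit squareTrace_hit,
    squareTrace_integral hint hnorm, one_smul]

lemma eq_zero_of_squareTrace_mul_right {Λ : H} (hint : ∀ h : H, h * Λ = counit (R := k) h • Λ)
    (hnorm : counit (R := k) Λ = 1) {x : H} (hx : ∀ y, squareTrace k H (x * y) = 0) : x = 0 := by
  have h1 := antipode_mul_contractRight_comul_integral hint (squareTrace k H) x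
  have h2 : squareTrace k H ∘ₗ LinearMap.mulLeft k x = 0 := LinearMap.ext hx
  rw [h2, contractRight_comul_of_hit squareTrace_hit, squareTrace_integral hint hnorm,
    one_smul, mul_one] at h1
  refine antipode_injective_of_integral hint hnorm (h1.trans ?_)
  simp [contractRight]

lemma eq_zero_of_squareTrace_mul_left {Λ : H} (hint : ∀ h : H, h * Λ = counit (R := k) h • Λ)
    (hnorm : counit (R := k) Λ = 1) {x : H} (hx : ∀ y, squareTrace k H (y * x) = 0) : x = 0 := by
  refine eq_zero_of_squareTrace_mul_right hint hnorm fun y => ?_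
  obtain ⟨z, rfl⟩ := (antipodeSq_bijective hint hnorm).2 y
  rw [← squareTrace_mul, hx]

variable (k) in
/-- The distinguished group-like element attached to the integral `Λ`. -/
noncomputable def modular (Λ : H) : H := hit (squareTrace k H) Λ

lemma hit_squareTrace {Λ : H} (hint : ∀ h : H, h * Λ = counit (R := k) h • Λ)
    (hnorm : counit (R := k) Λ = 1) (h : H) :
    hit (squareTrace k H) h = squareTrace k H h • modular k Λ := by
  rw [← sub_eq_zero, ← Module.forall_dual_apply_eq_zero_iff k]
  intro φ
  have hf : ∀ (θ : Module.Dual k H) (h : H), (φ ∘ₗ hit (squareTrace k H)) (hit θ h) =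
      θ 1 * (φ ∘ₗ hit (squareTrace k H)) h := by
    intro θ h
    rw [LinearMap.comp_apply, LinearMap.comp_apply, hit_apply _ (hit θ h), comul_hit,
      hit_apply _ h]
    induction comul (R := k) h with
    | zero => simp
    | tmul a b => simp [squareTrace_hit, mul_assoc]
    | add x y hx hy => simp only [map_add, hx, hy, mul_add]
  have := congr($(eq_smul_squareTrace hint hnorm hf) h)
  rw [map_sub, map_smul, sub_eq_zero]
  refine this.trans ?_
  simp [modular, mul_comm]

lemma isGroupLikeElem_modular {Λ : H} (hint : ∀ h : H, h * Λ = counit (R := k) h • Λ)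
    (hnorm : counit (R := k) Λ = 1) : IsGroupLikeElem k (modular k Λ) where
  counit_eq_one := by
    rw [modular, hit_eq_sum _ (ℛ k Λ), map_sum]
    simp only [map_smul, smul_eq_mul, mul_comm (squareTrace k H _)]
    simp only [← smul_eq_mul, ← map_smul, ← map_sum, sum_counit_right_smul]
    exact squareTrace_integral hint hnorm
  comul_eq_tmul_self := by
    conv_lhs => rw [modular, comul_hit]
    have : ∀ x : H ⊗[k] H, (hit (squareTrace k H)).rTensor H x =
        modular k Λ ⊗ₜ[k] contractLeft (squareTrace k H) x := by
      intro x
      induction x with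
      | zero => simp
      | tmul a b => simp [hit_squareTrace hint hnorm, TensorProduct.smul_tmul]
      | add x y hx hy => simp [hx, hy, TensorProduct.tmul_add]
    rw [this]
    rfl

lemma squareTrace_antipode_mul_modular {Λ : H} (hint : ∀ h : H, h * Λ = counit (R := k) h • Λ)
    (hnorm : counit (R := k) Λ = 1) (h : H) :
    squareTrace k H (antipode k h * modular k Λ) = squareTrace k H h := by
  set g := modular k Λ with hg
  have hgl : IsGroupLikeElem k g := isGroupLikeElem_modular hint hnorm
  let f : Module.Dual k H := squareTrace k H ∘ₗ LinearMap.mulRight k g ∘ₗ antipode k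
  have h1 : ∀ b : H, contractRight f (comul (R := k) b) = f b • 1 := by
    intro b
    apply antipode_injective_of_integral hint hnorm
    have h2 := hit_squareTrace hint hnorm (antipode k b * g)
    have h3 : ∀ x : H ⊗[k] H, contractLeft (squareTrace k H)
        (TensorProduct.map (antipode k) (antipode k) (TensorProduct.comm k H H x) * (g ⊗ₜ g)) =
          antipode k (contractRight f x) * g := by
      intro x
      induction x with
      | zero => simp
      | tmul a b => simp [f]
      | add x y hx hy => simp only [map_add, hx, hy, add_mul]
    rw [hit_apply, Bialgebra.comul_mul, hgl.comul_eq_tmul_self, comul_antipode, h3] at h2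
    have h4 := congr($h2 * antipode k g)
    rw [mul_assoc, hgl.mul_antipode_cancel, mul_one, smul_mul_assoc, ← hg,
      hgl.mul_antipode_cancel] at h4
    simpa [f] using h4
  have hf : ∀ (φ : Module.Dual k H) (h : H), f (hit φ h) = φ 1 * f h := by
    intro φ h
    rw [hit_apply, ← dual_contractRight, h1, map_smul, smul_eq_mul, mul_comm]
  have h5 := congr($(eq_smul_squareTrace hint hnorm hf) h)
  have h6 : f Λ = 1 := by
    simp [f, antipode_integral hint hnorm, integral_mul hint hnorm, hgl.counit_eq_one,
      squareTrace_integral hint hnorm]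
  rw [h6, one_smul] at h5
  exact h5

lemma mul_modular {Λ : H} (hint : ∀ h : H, h * Λ = counit (R := k) h • Λ)
    (hnorm : counit (R := k) Λ = 1) (x : H) :
    x * modular k Λ = modular k Λ * antipodeSq k H (antipodeSq k H x) := by
  obtain ⟨a, rfl⟩ := (antipode_bijective_of_integral hint hnorm).2 x
  rw [← sub_eq_zero]
  refine eq_zero_of_squareTrace_mul_left hint hnorm fun y => ?_
  obtain ⟨b, rfl⟩ := (antipode_bijective_of_integral hint hnorm).2 y
  have h1 := squareTrace_mul (k := k) a b
  rw [← squareTrace_antipode_mul_modular hint hnorm (a * b),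
    ← squareTrace_antipode_mul_modular hint hnorm (b * _), antipode_mul_antidistrib,
    antipode_mul_antidistrib, mul_assoc (antipode k (antipodeSq k H a)),
    squareTrace_mul (antipode k (antipodeSq k H a))] at h1
  rw [mul_sub, map_sub, sub_eq_zero, ← mul_assoc, h1, ← mul_assoc]
  rfl

lemma exists_antipodeSq_pow_eq_one {Λ : H} (hint : ∀ h : H, h * Λ = counit (R := k) h • Λ)
    (hnorm : counit (R := k) Λ = 1) : ∃ m : ℕ, 0 < m ∧ antipodeSq k H ^ m = 1 := by
  set g := modular k Λ with hg
  have hgl : IsGroupLikeElem k g := isGroupLikeElem_modular hint hnorm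
  have hpow : ∀ (n : ℕ) (x : H), x * g ^ n = g ^ n * (antipodeSq k H ^ (2 * n)) x := by
    intro n
    induction n with
    | zero => simp
    | succ n ih =>
      intro x
      rw [pow_succ, ← mul_assoc, ih, mul_assoc, mul_modular hint hnorm, ← mul_assoc,
        mul_add, mul_one, add_comm, pow_add, pow_two]
      rfl
  have hfin : {a : H | IsGroupLikeElem k a}.Finite :=
    LinearIndependent.setFinite (R := k) linearIndepOn_isGroupLikeElem
  have := hfin.to_subtype
  obtain ⟨u, hu⟩ := hgl.isUnit
  have hu' : ¬ Function.Injective fun n : ℕ => u ^ n := by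
    intro hinj
    refine not_injective_infinite_finite
      (fun n : ℕ => (⟨g ^ n, hgl.pow⟩ : {a : H | IsGroupLikeElem k a})) fun i j hij => hinj ?_
    simpa [← hu, Units.ext_iff] using hij
  rw [injective_pow_iff_not_isOfFinOrder, not_not, isOfFinOrder_iff_pow_eq_one] at hu'
  obtain ⟨n, hn, hn1⟩ := hu'
  refine ⟨2 * n, by omega, LinearMap.ext fun x => ?_⟩
  have h1 := hpow n x
  rw [← hu, ← Units.val_pow_eq_pow_val, hn1] at h1
  simpa using h1.symm

end Modular

section Maschke

variable {k H : Type*} [Field k] [Ring H] [HopfAlgebra k H]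

lemma sum_mul_map_antipode_mul {Λ : H} (hint : ∀ h : H, h * Λ = counit (R := k) h • Λ)
    (hnorm : counit (R := k) Λ = 1) {M : Type*} [AddCommGroup M] [Module k M]
    (F : H →ₗ[k] H →ₗ[k] M) {ι : Type*} (r : Repr k Λ ι) (h : H) :
    ∑ i ∈ r.index, F (h * r.left i) (antipode k (r.right i)) =
      ∑ i ∈ r.index, F (r.left i) (antipode k (r.right i) * h) := by
  obtain ⟨h, rfl⟩ := (antipode_bijective_of_integral hint hnorm).2 h
  have h1 := congr(TensorProduct.lift (F.compl₂ (antipode k)) $(tmul_mul_comul_integral hint h))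
  rw [← r.eq] at h1
  simpa [Finset.mul_sum, antipode_mul_antidistrib] using h1

lemma isSemisimpleRing_of_integral {Λ : H} (hint : ∀ h : H, h * Λ = counit (R := k) h • Λ)
    (hnorm : counit (R := k) Λ = 1) : IsSemisimpleRing H := by
  refine { exists_isCompl := fun p => ?_ }
  obtain ⟨π, hπ⟩ := LinearMap.exists_leftInverse_of_injective (p.restrictScalars k).subtype
    (LinearMap.ker_eq_bot.2 Subtype.val_injective)
  let r := ℛ k Λ
  let F (x : H) : H →ₗ[k] H →ₗ[k] H := LinearMap.mk₂ k
    (fun a b => a * (π (b * x) : H)) (by simp [add_mul]) (by simp)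
    (by simp [add_mul, mul_add]) (by simp)
  have hmem : ∀ x, ∑ i ∈ r.index, F x (r.left i) (antipode k (r.right i)) ∈ p := fun x =>
    Submodule.sum_mem _ fun i _ => p.smul_mem _ (π _).2
  let P : H →ₗ[H] p :=
    { toFun := fun x => ⟨_, hmem x⟩
      map_add' := fun x y => by
        ext
        simp [F, mul_add, Finset.sum_add_distrib]
      map_smul' := fun h x => by
        ext
        have := sum_mul_map_antipode_mul hint hnorm (F x) r h
        simpa [F, Finset.mul_sum, mul_assoc] using this.symm }
  refine ⟨LinearMap.ker P, LinearMap.isCompl_of_proj (f := P) fun x => ?_⟩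
  ext
  have h1 : ∀ b : H, (π (b * (x : H)) : H) = b * x := fun b =>
    congr(($hπ ⟨b * x, p.smul_mem b x.2⟩ : H))
  change ∑ i ∈ r.index, r.left i * (π (antipode k (r.right i) * (x : H)) : H) = x
  simp only [h1, ← mul_assoc]
  rw [← Finset.sum_mul, sum_mul_antipode_eq_smul, hnorm, one_smul, one_mul]

end Maschke

section RootsOfUnity

variable {k : Type*} [Field k] [CharZero k]

lemma sum_eq_zero_of_sum_mul_sum_inv_eq_zero {ι : Type*} [Fintype ι] {M : ℕ} (hM : 0 < M)
    (s : ι → Finset k) (n : ι → k → ℕ) (hs : ∀ i, ∀ μ ∈ s i, μ ^ M = 1)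
    (h : ∑ i, (∑ μ ∈ s i, (n i μ : k) * μ) * (∑ μ ∈ s i, (n i μ : k) * μ⁻¹) = 0) (i : ι) :
    ∑ μ ∈ s i, (n i μ : k) * μ = 0 := by
  classical
  let K := algebraicClosure ℚ k
  have : Algebra.IsAlgebraic ℚ K := algebraicClosure.isAlgebraic ℚ k
  let φ : K →ₐ[ℚ] ℂ := IsAlgClosed.lift
  have hmem : ∀ i, ∀ μ ∈ s i, μ ∈ K := by
    intro i μ hμ
    rw [mem_algebraicClosure_iff]
    exact (IsIntegral.of_pow hM (by rw [hs i μ hμ]; exact isIntegral_one)).isAlgebraic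
  have key : ∀ i, ∃ c : K, (c : k) = ∑ μ ∈ s i, (n i μ : k) * μ ∧ ∃ c' : K,
      (c' : k) = ∑ μ ∈ s i, (n i μ : k) * μ⁻¹ ∧ φ c' = star (φ c) := by
    intro i
    refine ⟨∑ μ ∈ (s i).attach, (n i μ : K) * ⟨μ, hmem i μ μ.2⟩, ?_,
      ∑ μ ∈ (s i).attach, (n i μ : K) * (⟨μ, hmem i μ μ.2⟩ : K)⁻¹, ?_, ?_⟩
    · rw [← Finset.sum_attach (s i)]
      push_cast
      rfl
    · rw [← Finset.sum_attach (s i)]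
      push_cast
      rfl
    · simp only [map_sum, map_mul, map_natCast, map_inv₀, star_sum, star_mul', star_natCast]
      refine Finset.sum_congr rfl fun μ _ => ?_
      have h1 : φ ⟨μ, hmem i μ μ.2⟩ ^ M = 1 := by
        rw [← map_pow, ← map_one φ]
        congr 1
        ext
        exact hs i μ μ.2
      rw [Complex.inv_eq_conj (Complex.norm_eq_one_of_pow_eq_one h1 hM.ne')]
      rfl
  choose c hc c' hc' hcc using key
  have h2 : ∑ i, c i * c' i = 0 := by
    ext
    push_cast
    simpa [hc, hc'] using h
  have h3 := congr(φ $h2)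
  rw [map_sum, map_zero] at h3
  simp only [map_mul, hcc] at h3
  have h4 : ∑ i, Complex.normSq (φ (c i)) = 0 := by
    have : ∀ i, φ (c i) * star (φ (c i)) = (Complex.normSq (φ (c i)) : ℂ) := fun i =>
      Complex.mul_conj _
    simp only [this] at h3
    exact_mod_cast h3
  rw [Finset.sum_eq_zero_iff_of_nonneg fun i _ => Complex.normSq_nonneg _] at h4
  have h5 := h4 i (Finset.mem_univ i)
  rw [Complex.normSq_eq_zero, map_eq_zero] at h5
  rw [← hc, h5]
  rfl

variable [IsAlgClosed k]

lemma exists_trace_eq_sum_of_pow_eq_one {V : Type*} [AddCommGroup V] [Module k V]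
    [FiniteDimensional k V] {f g : Module.End k V} {M : ℕ} (hM : 0 < M) (hf : f ^ M = 1)
    (hg : g * f = 1) :
    ∃ (s : Finset k) (n : k → ℕ), (∀ μ ∈ s, μ ^ M = 1) ∧
      LinearMap.trace k V f = ∑ μ ∈ s, (n μ : k) * μ ∧
      LinearMap.trace k V g = ∑ μ ∈ s, (n μ : k) * μ⁻¹ := by
  classical
  have hss : f.IsSemisimple := by
    refine Module.End.isSemisimple_of_squarefree_aeval_eq_zero
      (p := Polynomial.X ^ M - 1) (Polynomial.Separable.squarefree ?_) (by simp [hf])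
    rw [Polynomial.X_pow_sub_one_separable_iff]
    exact_mod_cast hM.ne'
  have htop : ⨆ μ, f.eigenspace μ = ⊤ := by
    rw [← Module.End.iSup_maxGenEigenspace_eq_top f]
    exact iSup_congr fun μ => (hss.isFinitelySemisimple.maxGenEigenspace_eq_eigenspace μ).symm
  have hint := DirectSum.isInternal_submodule_of_iSupIndep_of_iSup_eq_top
    f.eigenspaces_iSupIndep htop
  have hfin : {μ | f.eigenspace μ ≠ ⊥}.Finite :=
    WellFoundedGT.finite_ne_bot_of_iSupIndep f.eigenspaces_iSupIndep
  have hgμ : ∀ μ, ∀ v ∈ f.eigenspace μ, v = μ • g v := by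
    intro μ v hv
    rw [Module.End.mem_eigenspace_iff] at hv
    rw [← map_smul, ← hv, ← Module.End.mul_apply, hg, Module.End.one_apply]
  have hμ0 : ∀ μ, f.eigenspace μ ≠ ⊥ → μ ^ M = 1 := by
    intro μ hμ
    obtain ⟨v, hv, hv0⟩ := Submodule.exists_mem_ne_zero_of_ne_bot hμ
    have h1 := (show f.HasEigenvector μ v from ⟨hv, hv0⟩).pow_apply M
    rw [hf, Module.End.one_apply] at h1
    exact (smul_left_injective k hv0 (by simpa using h1)).symm
  have hgm : ∀ μ, Set.MapsTo g (f.eigenspace μ) (f.eigenspace μ) := by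
    intro μ v hv
    have hfg : f * g = 1 := mul_eq_one_comm.1 hg
    rw [SetLike.mem_coe, Module.End.mem_eigenspace_iff, ← hgμ μ v hv, ← Module.End.mul_apply, hfg,
      Module.End.one_apply]
  refine ⟨hfin.toFinset, fun μ => Module.finrank k (f.eigenspace μ), ?_, ?_, ?_⟩
  · intro μ hμ
    exact hμ0 μ (by simpa using hμ)
  · rw [LinearMap.trace_eq_sum_trace_restrict' hint hfin
      (fun μ => f.mapsTo_genEigenspace_of_comm (Commute.refl f) μ 1)]
    refine Finset.sum_congr rfl fun μ _ => ?_
    have : f.restrict (f.mapsTo_genEigenspace_of_comm (Commute.refl f) μ 1) = μ • 1 := by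
      ext ⟨v, hv⟩
      exact Module.End.mem_eigenspace_iff.1 hv
    rw [this, map_smul, LinearMap.trace_one, smul_eq_mul, mul_comm]
  · rw [LinearMap.trace_eq_sum_trace_restrict' hint hfin hgm]
    refine Finset.sum_congr rfl fun μ hμ => ?_
    have hμ1 : μ ≠ 0 := by
      rintro rfl
      have := hμ0 0 (by simpa using hμ)
      simp [hM.ne'] at this
    have : g.restrict (hgm μ) = μ⁻¹ • 1 := by
      ext ⟨v, hv⟩
      change g v = μ⁻¹ • v
      rw [eq_inv_smul_iff₀ hμ1]
      exact (hgμ μ v hv).symm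
    rw [this, map_smul, LinearMap.trace_one, smul_eq_mul, mul_comm]

end RootsOfUnity

section MatrixAlgebra

lemma exists_scalar_of_mul_comm {k ι : Type*} [Field k] [DecidableEq ι] {d : ι → ℕ}
    {z : Π i, Matrix (Fin (d i)) (Fin (d i)) k}
    (hz : ∀ x, x * z = z * x) (i : ι) : ∃ c : k, z i = Matrix.scalar (Fin (d i)) c := by
  have : z i ∈ Set.range (Matrix.scalar (Fin (d i))) := by
    refine Matrix.mem_range_scalar_of_commute_single fun a b _ => ?_
    have := congr($(hz (Pi.single i (Matrix.single a b 1))) i)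
    simpa [Commute, SemiconjBy] using this
  obtain ⟨c, hc⟩ := this
  exact ⟨c, hc.symm⟩

variable {k ι : Type*} [Field k] [Fintype ι] {d : ι → ℕ}

variable (k d) in
/-- The sum of the traces of the components. -/
noncomputable def sumTrace : (Π i, Matrix (Fin (d i)) (Fin (d i)) k) →ₗ[k] k :=
  ∑ i, Matrix.traceLinearMap (Fin (d i)) k k ∘ₗ LinearMap.proj i

lemma sumTrace_apply (x : Π i, Matrix (Fin (d i)) (Fin (d i)) k) :
    sumTrace k d x = ∑ i, (x i).trace := by
  simp [sumTrace]

lemma sumTrace_mul_comm (x y : Π i, Matrix (Fin (d i)) (Fin (d i)) k) :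
    sumTrace k d (x * y) = sumTrace k d (y * x) := by
  rw [sumTrace_apply, sumTrace_apply]
  exact Finset.sum_congr rfl fun i _ => Matrix.trace_mul_comm _ _

variable [DecidableEq ι]

lemma trace_mulLeft_mul_mulRight (a c : Π i, Matrix (Fin (d i)) (Fin (d i)) k) :
    LinearMap.trace k _ (LinearMap.mulLeft k a * LinearMap.mulRight k c) =
      ∑ i, (a i).trace * (c i).trace := by
  rw [LinearMap.trace_eq_matrix_trace k (Pi.basis fun i => Matrix.stdBasis k (Fin (d i)) (Fin (d i))),
    Matrix.trace, Fintype.sum_sigma]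
  refine Finset.sum_congr rfl fun i _ => ?_
  rw [Fintype.sum_prod_type, Matrix.trace, Matrix.trace, Finset.sum_mul_sum]
  refine Finset.sum_congr rfl fun x _ => Finset.sum_congr rfl fun y _ => ?_
  rw [Matrix.diag_apply, LinearMap.toMatrix_apply, Pi.basis_apply, Pi.basis_repr]
  have h : ∀ X : Matrix (Fin (d i)) (Fin (d i)) k,
      (Matrix.stdBasis k (Fin (d i)) (Fin (d i))).repr X (x, y) = X x y := by
    intro X
    simp [Matrix.stdBasis]
  rw [h, Matrix.stdBasis_eq_single]
  simp [Matrix.mul_apply, Matrix.single_apply, ite_and]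

lemma eq_zero_of_sumTrace_mul {x : Π i, Matrix (Fin (d i)) (Fin (d i)) k}
    (hx : ∀ y, sumTrace k d (y * x) = 0) : x = 0 := by
  ext1 i
  rw [Matrix.ext_iff_trace_mul_left]
  intro y
  have := hx (Pi.single i y)
  rw [sumTrace_apply, Finset.sum_eq_single i] at this
  · simpa using this
  · intro j _ hj
    simp [hj]
  · simp

lemma exists_eq_sumTrace_mul (f : Module.Dual k (Π i, Matrix (Fin (d i)) (Fin (d i)) k)) :
    ∃ u, ∀ x, f x = sumTrace k d (u * x) := by
  let F : (Π i, Matrix (Fin (d i)) (Fin (d i)) k) →ₗ[k]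
      Module.Dual k (Π i, Matrix (Fin (d i)) (Fin (d i)) k) :=
    (LinearMap.mul k _).compr₂ (sumTrace k d)
  have hF : Function.Injective F := by
    rw [injective_iff_map_eq_zero]
    intro u hu
    refine eq_zero_of_sumTrace_mul fun y => ?_
    rw [sumTrace_mul_comm]
    exact congr($hu y)
  obtain ⟨u, hu⟩ := (LinearMap.injective_iff_surjective_of_finrank_eq_finrank
    Subspace.dual_finrank_eq.symm).1 hF f
  exact ⟨u, fun x => congr($hu.symm x)⟩

lemma trace_eq_zero_of_sum_trace_mul_trace_inv [IsAlgClosed k] [CharZero k] [∀ i, NeZero (d i)]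
    {u v : Π i, Matrix (Fin (d i)) (Fin (d i)) k} (hvu : v * u = 1) {M : ℕ} (hM : 0 < M)
    (hu : ∀ x, x * u ^ M = u ^ M * x) (h : ∑ i, (u i).trace * (v i).trace = 0) (i : ι) :
    (u i).trace = 0 := by
  have hvu' : ∀ i, v i * u i = 1 := fun i => congr($hvu i)
  choose c hc using exists_scalar_of_mul_comm hu
  choose r hr using fun i => IsAlgClosed.exists_pow_nat_eq (c i) hM
  have hur : ∀ i, u i ^ M = r i ^ M • 1 := by
    intro i
    rw [hr, ← Pi.pow_apply, hc]
    simp [Matrix.smul_one_eq_diagonal]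
  have hr0 : ∀ i, r i ≠ 0 := by
    intro i hi
    have h1 : u i ^ M = 0 := by
      rw [hur, hi, zero_pow hM.ne', zero_smul]
    have h2 : v i ^ M * u i ^ M = 1 := by
      have h3 : Commute (v i) (u i) := by
        rw [Commute, SemiconjBy, hvu', mul_eq_one_comm.1 (hvu' i)]
      rw [← h3.mul_pow, hvu', one_pow]
    rw [h1, mul_zero] at h2
    exact zero_ne_one h2
  have key : ∀ i, ∃ (s : Finset k) (n : k → ℕ), (∀ μ ∈ s, μ ^ M = 1) ∧
      (r i)⁻¹ * (u i).trace = ∑ μ ∈ s, (n μ : k) * μ ∧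
      r i * (v i).trace = ∑ μ ∈ s, (n μ : k) * μ⁻¹ := by
    intro i
    have := exists_trace_eq_sum_of_pow_eq_one (k := k) (f := Matrix.toLin' ((r i)⁻¹ • u i))
      (g := Matrix.toLin' (r i • v i)) hM (by
        rw [← Matrix.toLin'_pow, smul_pow, hur, inv_pow,
          inv_smul_smul₀ (pow_ne_zero _ (hr0 i)), Matrix.toLin'_one]
        rfl) (by
        rw [Module.End.mul_eq_comp, ← Matrix.toLin'_mul, smul_mul_smul_comm, hvu',
          mul_inv_cancel₀ (hr0 i), one_smul, Matrix.toLin'_one]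
        rfl)
    simpa only [Matrix.trace_toLin'_eq, Matrix.trace_smul, smul_eq_mul] using this
  choose s n hs h1 h2 using key
  have h3 := sum_eq_zero_of_sum_mul_sum_inv_eq_zero hM s n hs (by
    simp only [← h1, ← h2]
    rw [← h]
    refine Finset.sum_congr rfl fun i _ => ?_
    rw [mul_mul_mul_comm, inv_mul_cancel₀ (hr0 i), one_mul]) i
  rw [← h1] at h3
  simpa [hr0 i] using h3

end MatrixAlgebra

section TraceNeZero

variable {k H : Type*} [Field k] [IsAlgClosed k] [CharZero k] [Ring H] [HopfAlgebra k H]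
  [Module.Finite k H]

lemma squareTrace_one_ne_zero {Λ : H} (hint : ∀ h : H, h * Λ = counit (R := k) h • Λ)
    (hnorm : counit (R := k) Λ = 1) : squareTrace k H 1 ≠ 0 := by
  have := isSemisimpleRing_of_integral hint hnorm
  obtain ⟨n, d, hd, ⟨e⟩⟩ := IsSemisimpleRing.exists_algEquiv_pi_matrix_of_isAlgClosed k H
  obtain ⟨u, hu⟩ := exists_eq_sumTrace_mul (squareTrace k H ∘ₗ e.symm.toLinearMap)
  have hu' : ∀ x, squareTrace k H x = sumTrace k d (u * e x) := fun x => by simpa using hu (e x)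
  have hcomm : ∀ a, u * e a = e (antipodeSq k H a) * u := by
    intro a
    rw [← sub_eq_zero]
    refine eq_zero_of_sumTrace_mul fun y => ?_
    obtain ⟨b, rfl⟩ := e.surjective y
    have h1 := squareTrace_mul (k := k) a b
    rw [hu', hu', map_mul e, map_mul e] at h1
    rw [mul_sub, map_sub, sub_eq_zero, sumTrace_mul_comm, mul_assoc, h1, ← mul_assoc, ← mul_assoc,
      sumTrace_mul_comm, ← mul_assoc, sumTrace_mul_comm, ← mul_assoc]
  have hinj : Function.Injective (LinearMap.mulLeft k u) := by
    rw [injective_iff_map_eq_zero]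
    intro x hx
    rw [LinearMap.mulLeft_apply] at hx
    obtain ⟨a, rfl⟩ := e.surjective x
    rw [eq_zero_of_squareTrace_mul_right hint hnorm (x := a) fun y => by
      rw [hu', map_mul e, ← mul_assoc, hx, zero_mul, map_zero], map_zero]
  obtain ⟨v, huv⟩ := (LinearMap.injective_iff_surjective.1 hinj) 1
  rw [LinearMap.mulLeft_apply] at huv
  have hvu : v * u = 1 := by
    apply hinj
    rw [LinearMap.mulLeft_apply, LinearMap.mulLeft_apply, ← mul_assoc, huv, one_mul, mul_one]
  have htr : ∀ b, squareTrace k H b = ∑ i, ((e b * u) i).trace * (v i).trace := by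
    intro b
    rw [squareTrace_apply, ← LinearMap.trace_conj' _ e.toLinearEquiv,
      ← trace_mulLeft_mul_mulRight]
    congr 1
    refine LinearMap.ext fun x => ?_
    obtain ⟨a, rfl⟩ := e.surjective x
    rw [LinearEquiv.conj_apply_apply]
    simp only [Module.End.mul_apply, LinearMap.mulLeft_apply, LinearMap.mulRight_apply]
    rw [mul_assoc, ← mul_assoc u, hcomm, mul_assoc _ u, huv, mul_one]
    simp
  obtain ⟨M, hM, hSM⟩ := exists_antipodeSq_pow_eq_one hint hnorm
  have hpow : ∀ (n : ℕ) a, u ^ n * e a = e ((antipodeSq k H ^ n) a) * u ^ n := by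
    intro n
    induction n with
    | zero => simp
    | succ n ih =>
      intro a
      rw [pow_succ, mul_assoc, hcomm, ← mul_assoc, ih, pow_succ, mul_assoc]
      rfl
  intro h0
  rw [htr] at h0
  simp only [map_one, one_mul] at h0
  have h1 := trace_eq_zero_of_sum_trace_mul_trace_inv hvu hM (fun x => by
    obtain ⟨a, rfl⟩ := e.surjective x
    rw [hpow, hSM]
    rfl) h0
  choose c hc using exists_scalar_of_mul_comm (z := e Λ) fun x => by
    obtain ⟨a, rfl⟩ := e.surjective x
    rw [← map_mul, ← map_mul, hint, integral_mul hint hnorm]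
  have h2 := squareTrace_integral hint hnorm
  rw [htr, Finset.sum_eq_zero] at h2
  · exact zero_ne_one h2
  · intro i _
    rw [Pi.mul_apply, hc]
    have : Matrix.scalar (Fin (d i)) (c i) = c i • 1 := by
      simp [Matrix.smul_one_eq_diagonal]
    rw [this, smul_mul_assoc, one_mul, Matrix.trace_smul, h1, smul_zero, zero_mul]

lemma modular_eq_one {Λ : H} (hint : ∀ h : H, h * Λ = counit (R := k) h • Λ)
    (hnorm : counit (R := k) Λ = 1) : modular k Λ = 1 := by
  have h1 := hit_squareTrace hint hnorm (1 : H)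
  rw [hit_apply, Bialgebra.comul_one, Algebra.TensorProduct.one_def, contractLeft_tmul] at h1
  exact (smul_right_injective H (squareTrace_one_ne_zero hint hnorm) h1).symm

lemma antipodeSq_antipodeSq {Λ : H} (hint : ∀ h : H, h * Λ = counit (R := k) h • Λ)
    (hnorm : counit (R := k) Λ = 1) : antipodeSq k H * antipodeSq k H = 1 := by
  ext x
  have h1 := mul_modular hint hnorm x
  rw [modular_eq_one hint hnorm, mul_one, one_mul] at h1
  exact h1.symm

end TraceNeZero

section Involution

section Idempotent

variable {k V : Type*} [Field k] [AddCommGroup V] [Module k V] [Module.Finite k V]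

lemma exists_trace_eq_natCast {e : Module.End k V} (he : IsIdempotentElem e) :
    ∃ r : ℕ, r ≤ Module.finrank k V ∧ LinearMap.trace k V e = r :=
  ⟨_, Submodule.finrank_le _, (LinearMap.IsIdempotentElem.isProj_range e he).trace⟩

variable [CharZero k]

/-- An involution whose trace is an integral multiple of the dimension is a scalar. -/
lemma eq_one_or_eq_neg_one_of_trace {T : Module.End k V} (hT : T * T = 1)
    (h0 : LinearMap.trace k V T ≠ 0) {m : ℤ}
    (hm : LinearMap.trace k V T = m * Module.finrank k V) : T = 1 ∨ T = -1 := by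
  have hR : ∀ c : k, c * c = 1 → IsIdempotentElem ((2⁻¹ : k) • (1 + c • T)) := by
    intro c hc
    have : (1 + c • T) * (1 + c • T) = (2 : k) • (1 + c • T) := by
      rw [mul_add, add_mul, add_mul, one_mul, one_mul, mul_one, smul_mul_smul_comm, hT, hc, two_smul,
        one_smul]
      abel
    rw [IsIdempotentElem, smul_mul_smul_comm, this, smul_smul]
    congr 1
    norm_num
  have htr : ∀ c : k, LinearMap.trace k V ((2⁻¹ : k) • (1 + c • T)) =
      2⁻¹ * (Module.finrank k V + c * LinearMap.trace k V T) := by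
    intro c
    rw [map_smul, map_add, map_smul, LinearMap.trace_one, smul_eq_mul, smul_eq_mul]
  have hzero : ∀ c : k, c * c = 1 → Module.finrank k V + c * LinearMap.trace k V T = 0 →
      1 + c • T = 0 := by
    intro c hc h
    have h1 := LinearMap.IsIdempotentElem.eq_zero_of_trace_eq_zero (hR c hc) (by rw [htr, h, mul_zero])
    exact (smul_eq_zero.1 h1).resolve_left (inv_ne_zero two_ne_zero)
  obtain ⟨r, hr, hrt⟩ := exists_trace_eq_natCast (hR 1 (one_mul 1))
  rw [htr, one_mul, hm] at hrt
  have hrt' : (Module.finrank k V : ℤ) + m * Module.finrank k V = 2 * r := by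
    have : (Module.finrank k V : k) + m * Module.finrank k V = 2 * r := by
      rw [← hrt, mul_inv_cancel_left₀ two_ne_zero]
    exact_mod_cast this
  have hm0 : m ≠ 0 := by
    rintro rfl
    simp [hm] at h0
  have hn : 0 < (Module.finrank k V : ℤ) := by
    rw [Nat.cast_pos, Nat.pos_iff_ne_zero]
    intro h
    simp [hm, h] at h0
  have hr' : (r : ℤ) ≤ Module.finrank k V := by exact_mod_cast hr
  have h1 : m ≤ 1 := by nlinarith
  have h2 : -1 ≤ m := by
    by_contra! h
    nlinarith [Int.natCast_nonneg r]
  have h3 : m = 1 ∨ m = -1 := by omega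
  rcases h3 with rfl | rfl
  · left
    have h4 := hzero (-1) (by norm_num) (by rw [hm]; push_cast; ring)
    rw [neg_one_smul, ← sub_eq_add_neg, sub_eq_zero] at h4
    exact h4.symm
  · right
    have h4 := hzero 1 (by norm_num) (by rw [hm]; push_cast; ring)
    rw [one_smul, add_comm] at h4
    exact eq_neg_of_add_eq_zero_left h4

/-- The trace of the product of commuting involution and idempotent is an integer. -/
lemma exists_trace_mul_eq_intCast {T E : Module.End k V} (hT : T * T = 1)
    (hE : IsIdempotentElem E) (hTE : Commute T E) :
    ∃ m : ℤ, LinearMap.trace k V (T * E) = m := by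
  have hQ : IsIdempotentElem ((2⁻¹ : k) • (E + T * E)) := by
    have : (E + T * E) * (E + T * E) = (2 : k) • (E + T * E) := by
      have h1 : E * (T * E) = T * E := by rw [← mul_assoc, ← hTE.eq, mul_assoc, hE.eq]
      have h2 : T * E * E = T * E := by rw [mul_assoc, hE.eq]
      have h3 : T * E * (T * E) = E := by rw [mul_assoc, h1, ← mul_assoc, hT, one_mul]
      rw [mul_add, add_mul, add_mul, hE.eq, h1, h2, h3, two_smul]
      abel
    rw [IsIdempotentElem, smul_mul_smul_comm, this, smul_smul]
    congr 1
    norm_num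
  obtain ⟨r, -, hr⟩ := exists_trace_eq_natCast hQ
  obtain ⟨s, -, hs⟩ := exists_trace_eq_natCast hE
  refine ⟨2 * r - s, ?_⟩
  rw [map_smul, map_add, hs, smul_eq_mul] at hr
  push_cast
  rw [← hr]
  ring

end Idempotent

variable {k H : Type*} [Field k] [Ring H] [HopfAlgebra k H]

lemma antipodeSq_contractLeft (φ : Module.Dual k H) (x : H ⊗[k] H) :
    antipodeSq k H (contractLeft φ x) =
      contractLeft φ (TensorProduct.map LinearMap.id (antipodeSq k H) x) := by
  induction x with
  | zero => simp
  | tmul a b => simp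
  | add x y hx hy => simp [hx, hy]

lemma map_id_antipodeSq_mul (x y : H ⊗[k] H) :
    TensorProduct.map LinearMap.id (antipodeSq k H) (x * y) =
      TensorProduct.map LinearMap.id (antipodeSq k H) x *
        TensorProduct.map LinearMap.id (antipodeSq k H) y := by
  induction x with
  | zero => simp
  | tmul a b =>
    induction y with
    | zero => simp
    | tmul c d => simp [antipodeSq_mul]
    | add x y hx hy => simp [hx, hy, mul_add]
  | add x y hx hy => simp [hx, hy, add_mul]

lemma antipodeSq_mul_hit_mulLeft (f : Module.Dual k H) (y : H) :
    antipodeSq k H * hit (f ∘ₗ LinearMap.mulLeft k y) =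
      ∑ i ∈ (ℛ k y).index, LinearMap.mulLeft k (antipode k ((ℛ k y).right i)) *
        (antipodeSq k H * hit f * LinearMap.mulLeft k ((ℛ k y).left i)) := by
  ext h
  simp only [LinearMap.sum_apply, Module.End.mul_apply, LinearMap.mulLeft_apply, hit_apply,
    antipodeSq_contractLeft, Bialgebra.comul_mul, map_id_antipodeSq_mul]
  rw [← contractLeft_tmul_one_mul, ← sum_antipode_mul_map_comul y (ℛ k y), Finset.sum_mul, map_sum]
  refine Finset.sum_congr rfl fun i _ => ?_
  rw [mul_assoc, contractLeft_one_tmul_mul]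
  rfl

lemma hit_mul_hit (φ ψ : Module.Dual k H) : hit φ * hit ψ = hit (φ ∘ₗ hit ψ) := by
  ext h
  rw [Module.End.mul_apply, hit_apply, comul_hit, hit_apply]
  induction comul (R := k) h with
  | zero => simp
  | tmul a b => simp
  | add x y hx hy => simp [hx, hy]

lemma hit_smul (c : k) (φ : Module.Dual k H) : hit (c • φ) = c • hit φ := by
  ext h
  simp [hit_eq_sum _ (ℛ k h), Finset.smul_sum, mul_smul]

lemma hit_counit : hit (counit (R := k) (A := H)) = 1 := by
  ext h
  rw [hit_eq_sum _ (ℛ k h), sum_counit_smul, Module.End.one_apply]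

variable (k H) in
/-- The character of the left regular representation. -/
noncomputable def regularTrace : Module.Dual k H :=
  LinearMap.trace k H ∘ₗ LinearMap.mul k H

lemma regularTrace_apply (h : H) :
    regularTrace k H h = LinearMap.trace k H (LinearMap.mulLeft k h) := rfl

lemma trace_antipodeSq_mul_hit_mulLeft (f : Module.Dual k H) (y : H) :
    LinearMap.trace k H (antipodeSq k H * hit (f ∘ₗ LinearMap.mulLeft k y)) =
      counit (R := k) y * LinearMap.trace k H (antipodeSq k H * hit f) := by
  rw [antipodeSq_mul_hit_mulLeft, map_sum]
  simp_rw [LinearMap.trace_mul_comm k (LinearMap.mulLeft k (antipode k _)), mul_assoc _ _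
    (LinearMap.mulLeft k (antipode k _)), Module.End.mul_eq_comp (LinearMap.mulLeft k _),
    ← LinearMap.mulLeft_mul]
  rw [← map_sum, ← Finset.mul_sum]
  have : ∑ i ∈ (ℛ k y).index, LinearMap.mulLeft k ((ℛ k y).left i * antipode k ((ℛ k y).right i)) =
      counit (R := k) y • (1 : Module.End k H) := by
    ext h
    simp only [LinearMap.sum_apply, LinearMap.mulLeft_apply, ← Finset.sum_mul,
      sum_mul_antipode_eq_smul]
    simp
  rw [this, mul_smul_comm, mul_one, map_smul, smul_eq_mul]

lemma trace_antipodeSq_mul_hit {Λ : H} (hint : ∀ h : H, h * Λ = counit (R := k) h • Λ)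
    (hnorm : counit (R := k) Λ = 1) (f : Module.Dual k H) :
    LinearMap.trace k H (antipodeSq k H * hit f) = f Λ * LinearMap.trace k H (antipodeSq k H) := by
  have h1 := trace_antipodeSq_mul_hit_mulLeft f Λ
  have h2 : f ∘ₗ LinearMap.mulLeft k Λ = f Λ • counit (R := k) := by
    ext h
    simp [integral_mul hint hnorm, mul_comm]
  rw [hnorm, one_mul, h2, hit_smul, hit_counit, mul_smul_comm, mul_one, map_smul,
    smul_eq_mul] at h1
  exact h1.symm

variable [Module.Finite k H]

lemma regularTrace_integral {Λ : H} (hint : ∀ h : H, h * Λ = counit (R := k) h • Λ)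
    (hnorm : counit (R := k) Λ = 1) : regularTrace k H Λ = 1 := by
  have : LinearMap.mulLeft k Λ = (counit (R := k)).smulRight Λ := by
    ext x
    simp [integral_mul hint hnorm]
  rw [regularTrace_apply, this, LinearMap.trace_smulRight, hnorm]

lemma regularTrace_hit (h : H) :
    regularTrace k H (hit (regularTrace k H) h) =
      Module.finrank k H * regularTrace k H h := by
  let Ψ : H ⊗[k] H →ₗ[k] H ⊗[k] H :=
    TensorProduct.lift ((LinearMap.mul k (H ⊗[k] H)).compl₁₂ comul
      (includeRight : H →ₐ[k] H ⊗[k] H).toLinearMap)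
  have hΨ : ∀ a b, Ψ (a ⊗ₜ b) = comul a * (1 ⊗ₜ b) := fun a b => rfl
  have hsurj : Function.Surjective Ψ := by
    rw [← LinearMap.range_eq_top, eq_top_iff, ← TensorProduct.span_tmul_eq_top, Submodule.span_le]
    rintro _ ⟨a, b, rfl⟩
    refine ⟨∑ i ∈ (ℛ k a).index, (ℛ k a).left i ⊗ₜ (antipode k ((ℛ k a).right i) * b), ?_⟩
    have h1 : (toConv comul * toConv ((includeRight : H →ₐ[k] H ⊗[k] H).toLinearMap ∘ₗ
      antipode k) : WithConv (H →ₗ[k] H ⊗[k] H)) a = a ⊗ₜ 1 :=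
      congr(ofConv $(comul_mul_includeRight_antipode (k := k) (H := H)) a)
    rw [(ℛ k a).convMul_apply] at h1
    have h2 : a ⊗ₜ[k] b = (a ⊗ₜ 1) * (1 ⊗ₜ b) := by simp
    rw [h2, ← h1, map_sum, Finset.sum_mul]
    refine Finset.sum_congr rfl fun i _ => ?_
    rw [hΨ, mul_assoc]
    simp
  let e := LinearEquiv.ofBijective Ψ ⟨LinearMap.injective_iff_surjective.2 hsurj, hsurj⟩
  have h1 : e.conj (TensorProduct.map (LinearMap.mulLeft k h) LinearMap.id) =
      LinearMap.mulLeft k (comul (R := k) h) := by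
    refine LinearMap.ext fun x => ?_
    obtain ⟨x, rfl⟩ := e.surjective x
    rw [LinearEquiv.conj_apply_apply, e.symm_apply_apply]
    change Ψ _ = _ * Ψ x
    induction x with
    | zero => simp
    | tmul a b => simp [hΨ, mul_assoc]
    | add x y hx hy => simp only [map_add, hx, hy, mul_add]
  have h2 := LinearMap.trace_conj' (TensorProduct.map (LinearMap.mulLeft k h) LinearMap.id) e
  rw [h1, LinearMap.trace_tensorProduct', LinearMap.trace_id,
    ← regularTrace_apply h, mul_comm] at h2
  rw [← h2, hit_apply]
  induction comul (R := k) h with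
  | zero => simp
  | tmul a b =>
    have : LinearMap.mulLeft k (a ⊗ₜ[k] b) =
        TensorProduct.map (LinearMap.mulLeft k a) (LinearMap.mulLeft k b) := by
      ext; simp
    rw [this, LinearMap.trace_tensorProduct', contractLeft_tmul, map_smul, smul_eq_mul]
    rfl
  | add x y hx hy =>
    have : LinearMap.mulLeft k (x + y) = LinearMap.mulLeft k x + LinearMap.mulLeft k y :=
      map_add (LinearMap.mul k _) x y
    rw [map_add, map_add, hx, hy, this, map_add]

variable [IsAlgClosed k] [CharZero k]

lemma regularTrace_antipodeSq {Λ : H} (hint : ∀ h : H, h * Λ = counit (R := k) h • Λ)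
    (hnorm : counit (R := k) Λ = 1) (h : H) :
    regularTrace k H (antipodeSq k H h) = regularTrace k H h := by
  have h1 := antipodeSq_antipodeSq hint hnorm
  rw [regularTrace_apply, regularTrace_apply, ← mul_one (LinearMap.mulLeft k (antipodeSq k H h)),
    ← h1, ← mul_assoc, ← antipodeSq_mul_mulLeft, LinearMap.trace_mul_comm, ← mul_assoc, h1, one_mul]

lemma commute_antipodeSq_hit_regularTrace {Λ : H}
    (hint : ∀ h : H, h * Λ = counit (R := k) h • Λ)
    (hnorm : counit (R := k) Λ = 1) : Commute (antipodeSq k H) (hit (regularTrace k H)) := by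
  refine LinearMap.ext fun h => ?_
  rw [Module.End.mul_apply, Module.End.mul_apply, hit_apply, hit_apply, antipodeSq_apply h,
    comul_antipode_antipode]
  induction comul (R := k) h with
  | zero => simp
  | tmul a b =>
    rw [TensorProduct.map_tmul, contractLeft_tmul, contractLeft_tmul, map_smul]
    exact congr($((regularTrace_antipodeSq hint hnorm a).symm) • antipodeSq k H b)
  | add x y hx hy => simp only [map_add, hx, hy]

/-- The antipode of a semisimple Hopf algebra in characteristic zero is an involution. -/
theorem antipode_antipode_of_integral {Λ : H} (hint : ∀ h : H, h * Λ = counit (R := k) h • Λ)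
    (hnorm : counit (R := k) Λ = 1) (h : H) : antipode k (antipode k h) = h := by
  have hH : Nontrivial H := nontrivial_of_ne Λ 0 fun h => by simp [h] at hnorm
  have hT := antipodeSq_antipodeSq hint hnorm
  have hn : (Module.finrank k H : k) ≠ 0 := Nat.cast_ne_zero.2 Module.finrank_pos.ne'
  have hE : IsIdempotentElem ((Module.finrank k H : k)⁻¹ • hit (regularTrace k H)) := by
    have h1 : regularTrace k H ∘ₗ hit (regularTrace k H) =
        (Module.finrank k H : k) • regularTrace k H := LinearMap.ext regularTrace_hit
    rw [IsIdempotentElem, smul_mul_smul_comm, hit_mul_hit, h1, hit_smul, smul_smul,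
      inv_mul_cancel_right₀ hn]
  obtain ⟨m, hm⟩ := exists_trace_mul_eq_intCast hT hE
    ((commute_antipodeSq_hit_regularTrace hint hnorm).smul_right _)
  rw [mul_smul_comm, map_smul, trace_antipodeSq_mul_hit hint hnorm,
    regularTrace_integral hint hnorm, one_mul, smul_eq_mul, inv_mul_eq_iff_eq_mul₀ hn,
    mul_comm] at hm
  have h0 := squareTrace_one_ne_zero hint hnorm
  rw [squareTrace_apply, LinearMap.mulLeft_one, ← Module.End.one_eq_id, one_mul] at h0
  rcases eq_one_or_eq_neg_one_of_trace hT h0 hm with h1 | h1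
  · exact congr($h1 h)
  · have h2 : antipode k (antipode k (1 : H)) = -1 := congr($h1 1)
    rw [antipode_one, antipode_one] at h2
    have := congr(counit (R := k) $h2)
    rw [map_neg, Bialgebra.counit_one] at this
    norm_num at this

end Involution

section InvariantForms

variable {k H V : Type*} [Field k] [Ring H] [HopfAlgebra k H] [AddCommGroup V] [Module k V]

/-- A bilinear form `σ` on a representation with `σ(hv, w) = σ(v, S(h)w)`. -/
def IsInvariantForm (ρ : H →ₐ[k] Module.End k V) (σ : V →ₗ[k] V →ₗ[k] k) : Prop :=
  ∀ (h : H) (v w : V), σ (ρ h v) w = σ v (ρ (antipode k h) w)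

/-- The action of `H ⊗ H` on bilinear forms, `((a ⊗ b) β)(v, w) = β(av, bw)`. -/
noncomputable def formAction (ρ : H →ₐ[k] Module.End k V) :
    H ⊗[k] H →ₗ[k] Module.End k (V →ₗ[k] V →ₗ[k] k) :=
  TensorProduct.lift <| LinearMap.mk₂ k
    (fun a b =>
      { toFun := fun β => β.compl₁₂ (ρ a) (ρ b)
        map_add' := fun _ _ => rfl
        map_smul' := fun _ _ => rfl })
    (fun a a' b => by
      ext β v w
      change β (ρ (a + a') v) (ρ b w) = β (ρ a v) (ρ b w) + β (ρ a' v) (ρ b w)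
      simp)
    (fun c a b => by
      ext β v w
      change β (ρ (c • a) v) (ρ b w) = c * β (ρ a v) (ρ b w)
      simp)
    (fun a b b' => by
      ext β v w
      change β (ρ a v) (ρ (b + b') w) = β (ρ a v) (ρ b w) + β (ρ a v) (ρ b' w)
      simp)
    (fun c a b => by
      ext β v w
      change β (ρ a v) (ρ (c • b) w) = c * β (ρ a v) (ρ b w)
      simp)

variable (ρ : H →ₐ[k] Module.End k V)

@[simp]
lemma formAction_tmul (a b : H) (β : V →ₗ[k] V →ₗ[k] k) (v w : V) :
    formAction ρ (a ⊗ₜ b) β v w = β (ρ a v) (ρ b w) := rfl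

lemma formAction_mul_tmul_one (x : H ⊗[k] H) (h : H) (β : V →ₗ[k] V →ₗ[k] k) (v w : V) :
    formAction ρ (x * (h ⊗ₜ 1)) β v w = formAction ρ x β (ρ h v) w := by
  induction x with
  | zero => simp
  | tmul a b => simp
  | add x y hx hy => simp only [add_mul, map_add, LinearMap.add_apply, hx, hy]

lemma formAction_mul_one_tmul (x : H ⊗[k] H) (h : H) (β : V →ₗ[k] V →ₗ[k] k) (v w : V) :
    formAction ρ (x * (1 ⊗ₜ h)) β v w = formAction ρ x β v (ρ h w) := by
  induction x with
  | zero => simp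
  | tmul a b => simp
  | add x y hx hy => simp only [add_mul, map_add, LinearMap.add_apply, hx, hy]

lemma isInvariantForm_formAction_comul_integral {Λ : H}
    (hint : ∀ h : H, h * Λ = counit (R := k) h • Λ)
    (hnorm : counit (R := k) Λ = 1) (β : V →ₗ[k] V →ₗ[k] k) :
    IsInvariantForm ρ (formAction ρ (comul Λ) β) := by
  intro h v w
  rw [← formAction_mul_tmul_one, ← formAction_mul_one_tmul, comul_integral_mul_tmul hint hnorm]

variable {ρ}

lemma IsInvariantForm.formAction_comul {σ : V →ₗ[k] V →ₗ[k] k} (hσ : IsInvariantForm ρ σ) (h : H) :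
    formAction ρ (comul h) σ = counit (R := k) h • σ := by
  ext v w
  have h1 : ∀ x : H ⊗[k] H, formAction ρ x σ v w =
      σ v (ρ (LinearMap.mul' k H ((antipode k).rTensor H x)) w) := by
    intro x
    induction x with
    | zero => simp
    | tmul a b => simp [hσ a]
    | add x y hx hy => simp only [map_add, LinearMap.add_apply, hx, hy]
  rw [h1, mul_antipode_rTensor_comul_apply]
  simp [Algebra.algebraMap_eq_smul_one]

lemma IsInvariantForm.sub_smul {σ τ : V →ₗ[k] V →ₗ[k] k} (hσ : IsInvariantForm ρ σ)
    (hτ : IsInvariantForm ρ τ) (c : k) : IsInvariantForm ρ (σ - c • τ) := by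
  intro h v w
  simp [hσ h v w, hτ h v w]

lemma IsInvariantForm.flip {σ : V →ₗ[k] V →ₗ[k] k} (hσ : IsInvariantForm ρ σ)
    (hS : ∀ h : H, antipode k (antipode k h) = h) : IsInvariantForm ρ σ.flip := by
  intro h v w
  rw [LinearMap.flip_apply, LinearMap.flip_apply, hσ, hS]

lemma IsInvariantForm.ker_eq_bot {σ : V →ₗ[k] V →ₗ[k] k} (hσ : IsInvariantForm ρ σ)
    (hirr : ∀ U : Submodule k V, (∀ (h : H), ∀ v ∈ U, ρ h v ∈ U) → U = ⊥ ∨ U = ⊤)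
    (h0 : σ ≠ 0) : LinearMap.ker σ = ⊥ := by
  refine (hirr (LinearMap.ker σ) fun h v hv => ?_).resolve_right fun h => h0 (LinearMap.ker_eq_top.1 h)
  rw [LinearMap.mem_ker] at hv ⊢
  ext w
  rw [hσ, hv, LinearMap.zero_apply, LinearMap.zero_apply]

lemma form_eq_sum {ι : Type*} [Fintype ι] (b : Module.Basis ι k V) (σ : V →ₗ[k] V →ₗ[k] k) :
    σ = ∑ i, ∑ j, σ (b i) (b j) • (b.coord i).smulRight (b.coord j) := by
  classical
  refine b.ext fun p => b.ext fun q => ?_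
  simp [Finsupp.single_apply, LinearMap.sum_apply]

lemma trace_mul'_eq_sum_formAction {ι : Type*} [Fintype ι] (b : Module.Basis ι k V)
    (x : H ⊗[k] H) :
    LinearMap.trace k V (ρ (LinearMap.mul' k H x)) =
      ∑ i, ∑ j, formAction ρ x ((b.coord i).smulRight (b.coord j)) (b j) (b i) := by
  classical
  induction x with
  | zero => simp
  | tmul p q =>
    rw [LinearMap.mul'_apply, map_mul, LinearMap.trace_eq_matrix_trace k b, Matrix.trace]
    refine Finset.sum_congr rfl fun i _ => ?_
    rw [Matrix.diag_apply, LinearMap.toMatrix_apply, Module.End.mul_apply]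
    conv_lhs => rw [← b.sum_repr (ρ q (b i))]
    simp only [map_sum, map_smul, Finsupp.finsetSum_apply, Finsupp.smul_apply, smul_eq_mul,
      formAction_tmul, LinearMap.smulRight_apply, LinearMap.smul_apply, b.coord_apply, mul_comm]
  | add x y hx hy =>
    simp only [map_add, LinearMap.add_apply, hx, hy, Finset.sum_add_distrib]

variable [FiniteDimensional k V]

/-- A nonzero invariant form on a simple module, as an isomorphism with the dual. -/
lemma IsInvariantForm.exists_equiv {σ : V →ₗ[k] V →ₗ[k] k} (hσ : IsInvariantForm ρ σ)
    (hirr : ∀ U : Submodule k V, (∀ (h : H), ∀ v ∈ U, ρ h v ∈ U) → U = ⊥ ∨ U = ⊤)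
    (h0 : σ ≠ 0) : ∃ e : V ≃ₗ[k] Module.Dual k V, ∀ v, e v = σ v :=
  ⟨LinearEquiv.ofInjectiveOfFinrankEq σ (LinearMap.ker_eq_bot.1 (hσ.ker_eq_bot hirr h0))
    Subspace.dual_finrank_eq.symm, fun _ => rfl⟩

lemma IsInvariantForm.exists_eq_smul [IsAlgClosed k] [Nontrivial V] {σ τ : V →ₗ[k] V →ₗ[k] k}
    (hirr : ∀ U : Submodule k V, (∀ (h : H), ∀ v ∈ U, ρ h v ∈ U) → U = ⊥ ∨ U = ⊤)
    (hσ : IsInvariantForm ρ σ) (h0 : σ ≠ 0) (hτ : IsInvariantForm ρ τ) : ∃ c : k, τ = c • σ := by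
  obtain ⟨e, he⟩ := hσ.exists_equiv hirr h0
  obtain ⟨c, hc⟩ := Module.End.exists_eigenvalue (e.symm.toLinearMap ∘ₗ τ : Module.End k V)
  obtain ⟨v, hv⟩ := hc.exists_hasEigenvector
  refine ⟨c, ?_⟩
  by_contra hne
  have h1 := (hτ.sub_smul hσ c).ker_eq_bot hirr (sub_ne_zero.2 hne)
  refine hv.2 ((Submodule.mem_bot k).1 (h1 ▸ LinearMap.mem_ker.2 ?_))
  have h2 : e.symm (τ v) = c • v := hv.apply_eq_smul
  rw [LinearMap.sub_apply, LinearMap.smul_apply, ← he, ← map_smul, ← h2, e.apply_symm_apply,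
    sub_self]

end InvariantForms

section Indicator

variable {k H V : Type*} [Field k] [Ring H] [HopfAlgebra k H]
  [AddCommGroup V] [Module k V] [FiniteDimensional k V]
  {ρ : H →ₐ[k] Module.End k V} {Λ : H}

lemma trace_eq_zero_of_forall_not_isInvariantForm
    (hint : ∀ h : H, h * Λ = counit (R := k) h • Λ) (hnorm : counit (R := k) Λ = 1)
    (h0 : ∀ σ, IsInvariantForm ρ σ → σ = 0) :
    LinearMap.trace k V (ρ (LinearMap.mul' k H (comul (R := k) Λ))) = 0 := by
  rw [trace_mul'_eq_sum_formAction (Module.finBasis k V)]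
  simp [h0 _ (isInvariantForm_formAction_comul_integral ρ hint hnorm _)]

lemma IsInvariantForm.flip_eq_smul [IsAlgClosed k] [Nontrivial V]
    (hint : ∀ h : H, h * Λ = counit (R := k) h • Λ) (hnorm : counit (R := k) Λ = 1)
    (hS : ∀ h : H, antipode k (antipode k h) = h)
    (hirr : ∀ U : Submodule k V, (∀ (h : H), ∀ v ∈ U, ρ h v ∈ U) → U = ⊥ ∨ U = ⊤)
    {σ : V →ₗ[k] V →ₗ[k] k} (hσ : IsInvariantForm ρ σ) (h0 : σ ≠ 0) :
    σ.flip = LinearMap.trace k V (ρ (LinearMap.mul' k H (comul (R := k) Λ))) • σ := by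
  let b := Module.finBasis k V
  choose f hf using fun β => IsInvariantForm.exists_eq_smul hirr hσ h0
    (isInvariantForm_formAction_comul_integral ρ hint hnorm β)
  have h1 := (hσ.flip hS).formAction_comul Λ
  rw [hnorm, one_smul] at h1
  conv_lhs => rw [← h1, form_eq_sum b σ.flip]
  simp only [map_sum, map_smul]
  simp only [hf, trace_mul'_eq_sum_formAction b, LinearMap.smul_apply, Finset.sum_smul, smul_smul,
    smul_eq_mul, LinearMap.flip_apply, mul_comm (σ _ _)]

end Indicator

end FrobeniusSchur

/-- Let `H` be a semisimple Hopf algebra over an algebraically closed field `k`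
of characteristic 0 with normalized integral `Λ`, and let `V` be a simple `H`-module.  Define
the Frobenius-Schur indicator `ν_V = χ_V(Λ₁Λ₂)`.  Then `ν_V ∈ {0, 1, -1}`; `ν_V = 0` iff `V`
is not self-dual; `ν_V = 1` iff there is a nondegenerate bilinear form `σ` on `V` with
`σ(hv, w) = σ(v, S(h)w)` and `σ` symmetric; `ν_V = -1` iff there is such a nondegenerate form
that is skew-symmetric. -/
theorem frobenius_schur_hopf {k H : Type*} [Field k] [IsAlgClosed k] [CharZero k] [Ring H]
    [HopfAlgebra k H] (Λ : H)
    (hint : ∀ h : H, h * Λ = Coalgebra.counit (R := k) h • Λ)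
    (hnorm : Coalgebra.counit (R := k) Λ = 1)
    {V : Type*} [AddCommGroup V] [Module k V] [FiniteDimensional k V] [Nontrivial V]
    (ρ : H →ₐ[k] Module.End k V)
    (hirr : ∀ U : Submodule k V, (∀ (h : H), ∀ v ∈ U, ρ h v ∈ U) → U = ⊥ ∨ U = ⊤) :
    letI ν : k := LinearMap.trace k V (ρ (LinearMap.mul' k H (Coalgebra.comul (R := k) Λ)))
    (ν = 0 ∨ ν = 1 ∨ ν = -1) ∧
    (ν = 0 ↔ ¬ ∃ e : V ≃ₗ[k] Module.Dual k V, ∀ (h : H) (v : V),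
        e (ρ h v) = (ρ (HopfAlgebra.antipode (R := k) h)).dualMap (e v)) ∧
    (ν = 1 ↔ ∃ σ : V →ₗ[k] V →ₗ[k] k,
        (∀ v : V, (∀ w : V, σ v w = 0) → v = 0) ∧
        (∀ (h : H) (v w : V), σ (ρ h v) w = σ v (ρ (HopfAlgebra.antipode (R := k) h) w)) ∧
        (∀ v w : V, σ v w = σ w v)) ∧
    (ν = -1 ↔ ∃ σ : V →ₗ[k] V →ₗ[k] k,
        (∀ v : V, (∀ w : V, σ v w = 0) → v = 0) ∧
        (∀ (h : H) (v w : V), σ (ρ h v) w = σ v (ρ (HopfAlgebra.antipode (R := k) h) w)) ∧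
        (∀ v w : V, σ v w = - σ w v)) := by
  have := FrobeniusSchur.finite_of_integral hint hnorm
  have hS := FrobeniusSchur.antipode_antipode_of_integral hint hnorm
  set ν : k := LinearMap.trace k V (ρ (LinearMap.mul' k H (Coalgebra.comul (R := k) Λ)))
  have hflip : ∀ σ : V →ₗ[k] V →ₗ[k] k, FrobeniusSchur.IsInvariantForm ρ σ → σ ≠ 0 →
      σ.flip = ν • σ := fun σ hσ h0 => hσ.flip_eq_smul hint hnorm hS hirr h0
  have hinj : ∀ σ : V →ₗ[k] V →ₗ[k] k, σ ≠ 0 → ∀ c d : k, c • σ = d • σ → c = d :=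
    fun σ h0 c d h => smul_left_injective k (M := V →ₗ[k] V →ₗ[k] k) h0 h
  have hsq : ∀ σ : V →ₗ[k] V →ₗ[k] k, FrobeniusSchur.IsInvariantForm ρ σ → σ ≠ 0 →
      ν * ν = 1 := by
    intro σ hσ h0
    refine hinj σ h0 _ _ ?_
    rw [one_smul, mul_smul, ← hflip σ hσ h0]
    refine LinearMap.ext fun v => LinearMap.ext fun w => ?_
    rw [LinearMap.smul_apply, LinearMap.smul_apply, LinearMap.flip_apply, ← LinearMap.smul_apply,
      ← LinearMap.smul_apply, ← hflip σ hσ h0, LinearMap.flip_apply]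
  have hex : ν ≠ 0 → ∃ σ : V →ₗ[k] V →ₗ[k] k, FrobeniusSchur.IsInvariantForm ρ σ ∧ σ ≠ 0 := by
    intro h
    by_contra! h0
    exact h (FrobeniusSchur.trace_eq_zero_of_forall_not_isInvariantForm hint hnorm h0)
  have hnd : ∀ σ : V →ₗ[k] V →ₗ[k] k, FrobeniusSchur.IsInvariantForm ρ σ → σ ≠ 0 →
      ∀ v : V, (∀ w : V, σ v w = 0) → v = 0 := fun σ hσ h0 v hv =>
    (LinearMap.ker_eq_bot'.1 (hσ.ker_eq_bot hirr h0)) v (LinearMap.ext hv)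
  have hne : ∀ σ : V →ₗ[k] V →ₗ[k] k, (∀ v : V, (∀ w : V, σ v w = 0) → v = 0) → σ ≠ 0 := by
    rintro σ hσ rfl
    obtain ⟨v, hv⟩ := exists_ne (0 : V)
    exact hv (hσ v fun w => rfl)
  refine ⟨?_, ?_, ?_, ?_⟩
  · by_cases h : ν = 0
    · exact Or.inl h
    · obtain ⟨σ, hσ, h0⟩ := hex h
      exact Or.inr (mul_self_eq_one_iff.1 (hsq σ hσ h0))
  · rw [iff_not_comm]
    constructor
    · rintro ⟨e, he⟩ h
      have h1 := hsq e.toLinearMap (fun h v w => congr($(he h v) w)) (hne _ fun v hv =>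
        (map_eq_zero_iff e e.injective).1 (LinearMap.ext hv))
      rw [h, mul_zero] at h1
      exact zero_ne_one h1
    · intro h
      obtain ⟨σ, hσ, h0⟩ := hex h
      obtain ⟨e, he⟩ := hσ.exists_equiv hirr h0
      refine ⟨e, fun h v => LinearMap.ext fun w => ?_⟩
      rw [he, LinearMap.dualMap_apply, he, hσ]
  · constructor
    · intro h
      obtain ⟨σ, hσ, h0⟩ := hex (h ▸ one_ne_zero)
      refine ⟨σ, hnd σ hσ h0, hσ, fun v w => ?_⟩
      rw [← LinearMap.flip_apply, hflip σ hσ h0, h, one_smul]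
    · rintro ⟨σ, hσ, hinv, hsymm⟩
      have h0 := hne σ hσ
      refine hinj σ h0 _ _ ?_
      rw [← hflip σ hinv h0, one_smul]
      exact LinearMap.ext fun v => LinearMap.ext fun w => hsymm w v
  · constructor
    · intro h
      obtain ⟨σ, hσ, h0⟩ := hex (h ▸ neg_ne_zero.2 one_ne_zero)
      refine ⟨σ, hnd σ hσ h0, hσ, fun v w => ?_⟩
      rw [← LinearMap.flip_apply, hflip σ hσ h0, h, LinearMap.smul_apply, LinearMap.smul_apply,
        smul_eq_mul, neg_one_mul]
    · rintro ⟨σ, hσ, hinv, hskew⟩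
      have h0 := hne σ hσ
      refine hinj σ h0 _ _ (LinearMap.ext fun v => LinearMap.ext fun w => ?_)
      rw [← hflip σ hinv h0, LinearMap.flip_apply, hskew, LinearMap.smul_apply,
        LinearMap.smul_apply, smul_eq_mul, neg_one_mul]
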